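/- Let $d = p_1 \cdots p_r > 2$ be a square-free product of $r \geq 2$ distinct primes all congruent to $3 \pmod 8$. Then the rank of the 2-class group of $L_d = \mathbb{Q}(\zeta_8, \sqrt{d})$ equals $2r - 2$. -/

import Mathlib

namespace Amb

section abstract_groups

variable {X I : Type*} [CommGroup X] [CommGroup I]

/-- `x ↦ x / σ x`. -/
def del (σ : X →* X) : X →* X := MonoidHom.id X / σ

/-- `x ↦ x * σ x`. -/
def nrm (σ : X →* X) : X →* X := MonoidHom.id X * σ

@[simp] lemma del_apply (σ : X →* X) (x : X) : del σ x = x / σ x := rfl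
@[simp] lemma nrm_apply (σ : X →* X) (x : X) : nrm σ x = x * σ x := rfl

lemma mem_del_ker (σ : X →* X) (x : X) : x ∈ (del σ).ker ↔ σ x = x := by
  rw [MonoidHom.mem_ker, del_apply, div_eq_one, eq_comm]

lemma mem_nrm_ker (σ : X →* X) (x : X) : x ∈ (nrm σ).ker ↔ x * σ x = 1 := by
  rw [MonoidHom.mem_ker, nrm_apply]

lemma nrm_ker_eq (σ : X →* X) (hσ : ∀ x, σ (σ x) = x)
    (h90 : ∀ x, x * σ x = 1 → ∃ y, x = y / σ y) : (nrm σ).ker = (del σ).range := by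
  ext x
  rw [mem_nrm_ker]
  constructor
  · intro h
    obtain ⟨y, hy⟩ := h90 x h
    exact ⟨y, hy.symm⟩
  · rintro ⟨y, rfl⟩
    simp [hσ]

/-- The abstract ambiguous class number formula. -/
theorem ambiguous_abstract (σ : X →* X) (τ : I →* I) (f : X →* I)
    (hσ : ∀ x, σ (σ x) = x) (hτ : ∀ x, τ (τ x) = x) (hf : ∀ x, f (σ x) = τ (f x))
    (h90X : ∀ x, x * σ x = 1 → ∃ y, x = y / σ y)
    (h90I : ∀ x, x * τ x = 1 → ∃ y, x = y / τ y) :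
    f.range.relIndex (f.range.comap (del τ)) * (f.ker.map (del σ)).relIndex (f.ker ⊓ (nrm σ).ker) =
      ((del σ).ker.map f).relIndex (del τ).ker *
        (f.ker.map (nrm σ)).relIndex (f.ker ⊓ (nrm σ).range) := by
  set P := f.range with hP
  set E := f.ker with hE
  set A := P.comap (del τ) with hA
  set Is := (del τ).ker with hIs
  have hfd : ∀ x, f (del σ x) = del τ (f x) := fun x => by simp [hf]
  have hfn : ∀ x, f (nrm σ x) = nrm τ (f x) := fun x => by simp [hf]
  have hPA : P ≤ A := by
    rintro _ ⟨x, rfl⟩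
    exact ⟨del σ x, hfd x⟩
  have hIA : Is ≤ A := by
    intro x hx
    rw [hA, Subgroup.mem_comap, (MonoidHom.mem_ker).1 hx]
    exact one_mem _
  have h1 : P.relIndex (P ⊔ Is) * (P ⊔ Is).relIndex A = P.relIndex A :=
    Subgroup.relIndex_mul_relIndex _ _ _ le_sup_left (sup_le hPA hIA)
  have h2 : P.relIndex (P ⊔ Is) = P.relIndex Is := Subgroup.relIndex_sup_left _ _
  have hXs : (del σ).ker.map f ≤ P ⊓ Is := by
    rintro _ ⟨x, hx, rfl⟩
    refine Subgroup.mem_inf.2 ⟨⟨x, rfl⟩, ?_⟩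
    rw [hIs, MonoidHom.mem_ker, ← hfd, (MonoidHom.mem_ker).1 hx, map_one]
  have h3 : ((del σ).ker.map f).relIndex (P ⊓ Is) * (P ⊓ Is).relIndex Is =
      ((del σ).ker.map f).relIndex Is := Subgroup.relIndex_mul_relIndex _ _ _ hXs inf_le_right
  rw [Subgroup.inf_relIndex_right] at h3
  -- step 2
  set Y := E.comap (del σ) with hY
  have hEY : E ≤ Y := by
    intro x hx
    rw [hY, Subgroup.mem_comap, hE, MonoidHom.mem_ker, hfd, (MonoidHom.mem_ker).1 hx, map_one]
  have hsY : (del σ).ker ≤ Y := by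
    intro x hx
    rw [hY, Subgroup.mem_comap, (MonoidHom.mem_ker).1 hx]
    exact one_mem _
  have hYf : Y.map f = P ⊓ Is := by
    ext J
    constructor
    · rintro ⟨x, hx, rfl⟩
      refine Subgroup.mem_inf.2 ⟨⟨x, rfl⟩, ?_⟩
      rw [hIs, MonoidHom.mem_ker, ← hfd]
      exact hx
    · rintro ⟨⟨x, rfl⟩, hx⟩
      refine ⟨x, ?_, rfl⟩
      replace hx : f x ∈ (del τ).ker := hx
      rw [MonoidHom.mem_ker, ← hfd] at hx
      exact hx
  have hYd : Y.map (del σ) = E ⊓ (nrm σ).ker := by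
    rw [nrm_ker_eq σ hσ h90X]
    ext x
    constructor
    · rintro ⟨y, hy, rfl⟩
      exact ⟨hy, ⟨y, rfl⟩⟩
    · rintro ⟨hx, ⟨y, rfl⟩⟩
      exact ⟨y, hx, rfl⟩
  have h4 : ((del σ).ker.map f).relIndex (P ⊓ Is) = (E.map (del σ)).relIndex (E ⊓ (nrm σ).ker) := by
    rw [← hYf, ← hYd, Subgroup.relIndex_map_map, Subgroup.relIndex_map_map, ← hE,
      sup_eq_left.2 hEY, sup_eq_left.2 hsY, sup_comm]
  -- step 3
  set D := E.comap (nrm σ) with hD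
  have hED : E ≤ D := by
    intro x hx
    rw [hD, Subgroup.mem_comap, hE, MonoidHom.mem_ker, hfn, (MonoidHom.mem_ker).1 hx, map_one]
  have hnD : (nrm σ).ker ≤ D := by
    intro x hx
    rw [hD, Subgroup.mem_comap, (MonoidHom.mem_ker).1 hx]
    exact one_mem _
  have hAd : A.map (del τ) = P ⊓ (nrm τ).ker := by
    rw [nrm_ker_eq τ hτ h90I]
    ext x
    constructor
    · rintro ⟨y, hy, rfl⟩
      exact ⟨hy, ⟨y, rfl⟩⟩
    · rintro ⟨hx, ⟨y, rfl⟩⟩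
      exact ⟨y, hx, rfl⟩
  have hDf : D.map f = P ⊓ (nrm τ).ker := by
    ext J
    constructor
    · rintro ⟨x, hx, rfl⟩
      refine Subgroup.mem_inf.2 ⟨⟨x, rfl⟩, ?_⟩
      rw [MonoidHom.mem_ker, ← hfn]
      exact hx
    · rintro ⟨⟨x, rfl⟩, hx⟩
      refine ⟨x, ?_, rfl⟩
      replace hx : f x ∈ (nrm τ).ker := hx
      rw [MonoidHom.mem_ker, ← hfn] at hx
      exact hx
  have hDn : D.map (nrm σ) = E ⊓ (nrm σ).range := by
    ext x
    constructor
    · rintro ⟨y, hy, rfl⟩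
      exact ⟨hy, ⟨y, rfl⟩⟩
    · rintro ⟨hx, ⟨y, rfl⟩⟩
      exact ⟨y, hx, rfl⟩
  have hPd : P.map (del τ) = (del σ).range.map f := by
    ext J
    constructor
    · rintro ⟨_, ⟨x, rfl⟩, rfl⟩
      exact ⟨del σ x, ⟨x, rfl⟩, hfd x⟩
    · rintro ⟨_, ⟨x, rfl⟩, rfl⟩
      exact ⟨f x, ⟨x, rfl⟩, (hfd x).symm⟩
  have h5 : (P ⊔ Is).relIndex A = (E.map (nrm σ)).relIndex (E ⊓ (nrm σ).range) := by
    have e1 := Subgroup.relIndex_map_map (del τ) P A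
    rw [← hIs, sup_eq_left.2 hIA] at e1
    rw [← e1, hAd, ← hDf, hPd, Subgroup.relIndex_map_map, ← hDn, Subgroup.relIndex_map_map,
      ← hE, sup_eq_left.2 hED, sup_eq_left.2 hnD, nrm_ker_eq σ hσ h90X, sup_comm]
  rw [← h1, h2, h5, ← h3, h4]
  ring

/-- Herbrand quotient bookkeeping. -/
theorem herbrand_abstract (σ : X →* X) (hσ : ∀ x, σ (σ x) = x) (E : Subgroup X)
    (hE : ∀ x ∈ E, σ x ∈ E) :
    ((E ⊓ (del σ).ker).map (powMonoidHom 2)).relIndex (E ⊓ (del σ).ker) =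
      ((E ⊓ (del σ).ker) ⊔ (E ⊓ (nrm σ).ker)).relIndex E *
        (E.map (nrm σ)).relIndex (E ⊓ (del σ).ker) ∧
    ((E ⊓ (nrm σ).ker).map (powMonoidHom 2)).relIndex (E ⊓ (nrm σ).ker) =
      ((E ⊓ (del σ).ker) ⊔ (E ⊓ (nrm σ).ker)).relIndex E *
        (E.map (del σ)).relIndex (E ⊓ (nrm σ).ker) := by
  have key : ∀ (A B : Subgroup X) (g : X →* X), g.ker = B →
      (E ⊓ A).map (powMonoidHom 2) = (E ⊓ A).map g → E.map g ≤ E ⊓ A →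
      ((E ⊓ A).map (powMonoidHom 2)).relIndex (E ⊓ A) =
      ((E ⊓ A) ⊔ (E ⊓ B)).relIndex E * (E.map g).relIndex (E ⊓ A) := by
    intro A B g hg h1 h2
    rw [h1, ← Subgroup.relIndex_mul_relIndex _ _ _ (Subgroup.map_mono inf_le_left) h2,
      Subgroup.relIndex_map_map, hg]
    congr 1
    have e1 : E ⊔ B = (E ⊓ A ⊔ B) ⊔ E := by
      apply le_antisymm
      · exact sup_le le_sup_right (le_sup_right.trans le_sup_left)
      · exact sup_le (sup_le (inf_le_left.trans le_sup_left) le_sup_right) le_sup_left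
    rw [e1, Subgroup.relIndex_sup_left, ← Subgroup.inf_relIndex_right]
    congr 1
    rw [inf_comm E B]
    exact sup_inf_assoc_of_le B inf_le_left
  constructor
  · apply key _ _ _ rfl
    · ext x
      constructor
      · rintro ⟨y, hy, rfl⟩
        refine ⟨y, hy, ?_⟩
        have := (mem_del_ker _ _).1 hy.2
        simp [this, pow_two]
      · rintro ⟨y, hy, rfl⟩
        refine ⟨y, hy, ?_⟩
        have := (mem_del_ker _ _).1 hy.2
        simp [this, pow_two]
    · rintro _ ⟨y, hy, rfl⟩
      refine Subgroup.mem_inf.2 ⟨mul_mem (S := Subgroup X) hy (hE y hy), ?_⟩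
      rw [mem_del_ker]
      simp [hσ, mul_comm]
  · rw [sup_comm]
    apply key _ _ _ rfl
    · have h : ∀ y ∈ E ⊓ (nrm σ).ker, y ^ 2 = y / σ y := by
        intro y hy
        have := (mem_nrm_ker _ _).1 hy.2
        rw [eq_div_iff_mul_eq', pow_two, mul_assoc, this, mul_one]
      ext x
      constructor
      · rintro ⟨y, hy, rfl⟩
        exact ⟨y, hy, by simp [h y hy]⟩
      · rintro ⟨y, hy, rfl⟩
        exact ⟨y, hy, by simp [h y hy]⟩
    · rintro _ ⟨y, hy, rfl⟩
      refine Subgroup.mem_inf.2 ⟨div_mem (S := Subgroup X) hy (hE y hy), ?_⟩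
      rw [mem_nrm_ker]
      simp [hσ]

end abstract_groups

end Amb


namespace Amb

section fg_groups
open Module

lemma finrank_range_add_ker {M N : Type*} [AddCommGroup M] [AddCommGroup N] [Module.Finite ℤ M]
    (f : M →ₗ[ℤ] N) :
    finrank ℤ (LinearMap.range f) + finrank ℤ (LinearMap.ker f) = finrank ℤ M := by
  rw [← Submodule.finrank_quotient_add_finrank (LinearMap.ker f),
    (LinearMap.quotKerEquivRange f).finrank_eq]

lemma finrank_involution {M : Type*} [AddCommGroup M] [Module.Finite ℤ M] (σ : M →ₗ[ℤ] M)
    (hσ : ∀ x, σ (σ x) = x) :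
    finrank ℤ (LinearMap.ker (LinearMap.id - σ)) + finrank ℤ (LinearMap.ker (LinearMap.id + σ)) =
      finrank ℤ M := by
  rw [← finrank_range_add_ker (LinearMap.id + σ : M →ₗ[ℤ] M)]
  congr 1
  apply le_antisymm
  · -- multiplication by two on the fixed part
    let N := LinearMap.ker (LinearMap.id - σ)
    let g : N →ₗ[ℤ] M := (2 : ℤ) • N.subtype
    have h0 : finrank ℤ (LinearMap.ker g) = 0 := by
      rw [finrank_eq_zero_iff]
      rintro ⟨x, hx⟩
      refine ⟨2, two_ne_zero, ?_⟩
      apply Subtype.ext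
      apply Subtype.ext
      simpa [g] using hx
    have h1 := finrank_range_add_ker g
    rw [h0, add_zero] at h1
    change finrank ℤ N ≤ _
    rw [← h1]
    apply Submodule.finrank_mono
    rintro _ ⟨⟨x, hx⟩, rfl⟩
    refine ⟨x, ?_⟩
    have hx' : x - σ x = 0 := by simpa [N] using hx
    have hx2 : σ x = x := (sub_eq_zero.1 hx').symm
    simp [g, hx2, two_smul]
  · apply Submodule.finrank_mono
    rintro _ ⟨x, rfl⟩
    simp [hσ, add_comm]

lemma finrank_free_prod {M T : Type*} [AddCommGroup M] [Module.Finite ℤ M] [AddCommGroup T]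
    [Finite T] (n : ℕ) (φ : M ≃+ (Fin n →₀ ℤ) × T) : finrank ℤ M = n := by
  let g : M →ₗ[ℤ] (Fin n →₀ ℤ) :=
    ((AddMonoidHom.fst (Fin n →₀ ℤ) T).comp φ.toAddMonoidHom).toIntLinearMap
  have hg : ∀ x, g x = (φ x).1 := fun x => rfl
  rw [← finrank_range_add_ker g]
  have h1 : finrank ℤ (LinearMap.ker g) = 0 := by
    rw [finrank_eq_zero_iff]
    rintro ⟨x, hx⟩
    refine ⟨(Nat.card T : ℤ), by exact_mod_cast Nat.card_pos.ne', ?_⟩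
    apply Subtype.ext
    have hx1 : (φ x).1 = 0 := hx
    have hy : Nat.card T • (φ x).2 = 0 := card_nsmul_eq_zero'
    have : φ (Nat.card T • x) = 0 := by
      rw [map_nsmul]
      ext1
      · rw [Prod.smul_fst, hx1]; simp
      · rw [Prod.smul_snd, hy]; rfl
    have h2 : Nat.card T • x = 0 := (map_eq_zero_iff φ φ.injective).1 this
    simpa using h2
  have h2 : LinearMap.range g = ⊤ := by
    rw [LinearMap.range_eq_top]
    intro y
    exact ⟨φ.symm (y, 0), by simp [hg]⟩
  rw [h1, h2, finrank_top]
  simp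

lemma index_two_nsmul {M : Type*} [AddCommGroup M] [Module.Finite ℤ M] :
    (nsmulAddMonoidHom (α := M) 2).range.index =
      2 ^ finrank ℤ M * Nat.card (nsmulAddMonoidHom (α := M) 2).ker := by
  have hfg : AddGroup.FG M := by
    rw [← Module.Finite.iff_addGroup_fg]; infer_instance
  obtain ⟨n, ι, _, p, hp, e, ⟨φ⟩⟩ := AddCommGroup.equiv_free_prod_directSum_zmod M
  have : ∀ i, NeZero (p i ^ e i) := fun i => ⟨pow_ne_zero _ (hp i).ne_zero⟩
  classical
  set T := DirectSum ι fun i => ZMod (p i ^ e i)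
  have hT : Finite T := by
    have : Finite (Π i, ZMod (p i ^ e i)) := inferInstance
    exact Finite.of_equiv _ (DirectSum.addEquivProd (fun i => ZMod (p i ^ e i))).symm.toEquiv
  have hfr : finrank ℤ M = n := by
    exact finrank_free_prod n φ
  have e1 : (nsmulAddMonoidHom (α := M) 2).range.index =
      (nsmulAddMonoidHom (α := (Fin n →₀ ℤ) × T) 2).range.index := by
    simpa [AddEquiv.map_range_nsmulAddMonoidHom] using
      (AddSubgroup.index_map_equiv (nsmulAddMonoidHom (α := M) 2).range φ).symm
  have e2 : (nsmulAddMonoidHom (α := (Fin n →₀ ℤ) × T) 2).range =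
      (nsmulAddMonoidHom (α := (Fin n →₀ ℤ)) 2).range.prod (nsmulAddMonoidHom (α := T) 2).range := by
    ext ⟨x, y⟩
    simp [AddSubgroup.mem_prod]
  have e3 : Nat.card (nsmulAddMonoidHom (α := M) 2).ker =
      Nat.card (nsmulAddMonoidHom (α := T) 2).ker := by
    refine Nat.card_congr ⟨fun x => ⟨(φ x.1).2, ?_⟩, fun y => ⟨φ.symm (0, y.1), ?_⟩, ?_, ?_⟩
    · have := x.2
      simp only [AddMonoidHom.mem_ker, nsmulAddMonoidHom_apply] at this ⊢
      rw [← Prod.smul_snd, ← map_nsmul, this]; simp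
    · have := y.2
      simp only [AddMonoidHom.mem_ker, nsmulAddMonoidHom_apply] at this ⊢
      rw [← map_nsmul, Prod.smul_mk, this]; simp
    · rintro ⟨x, hx⟩
      apply Subtype.ext
      simp only [AddMonoidHom.mem_ker, nsmulAddMonoidHom_apply] at hx
      have h1 : (2 : ℕ) • (φ x).1 = 0 := by rw [← Prod.smul_fst, ← map_nsmul, hx]; simp
      have h2 : (φ x).1 = 0 := by simpa using h1
      simp only
      rw [← h2]
      simp
    · rintro ⟨x, hx⟩
      simp
  have e4 : (nsmulAddMonoidHom (α := T) 2).range.index =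
      Nat.card (nsmulAddMonoidHom (α := T) 2).ker := by
    have h1 := AddSubgroup.card_mul_index (nsmulAddMonoidHom (α := T) 2).range
    have h2 := AddSubgroup.card_mul_index (nsmulAddMonoidHom (α := T) 2).ker
    rw [AddSubgroup.index_ker, mul_comm, ← h1] at h2
    exact (Nat.eq_of_mul_eq_mul_left Nat.card_pos h2).symm
  rw [e1, e2, AddSubgroup.index_prod, AddSubgroup.index_range_nsmul, e4, e3, hfr]
  simp

lemma relIndex_sq {X : Type*} [CommGroup X] (H : Subgroup X) [Module.Finite ℤ (Additive H)]
    (ε : X) (hε : ε ∈ H) (hε1 : ε ≠ 1) (h2 : ∀ x : X, x ^ 2 = 1 ↔ x = 1 ∨ x = ε) :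
    (H.map (powMonoidHom 2)).relIndex H = 2 ^ (finrank ℤ (Additive H) + 1) := by
  have h := index_two_nsmul (M := Additive H)
  have e1 : (nsmulAddMonoidHom (α := Additive H) 2).range.index =
      (H.map (powMonoidHom 2)).relIndex H := by
    have : (nsmulAddMonoidHom (α := Additive H) 2).range =
        Subgroup.toAddSubgroup ((H.map (powMonoidHom 2)).subgroupOf H) := by
      ext x
      constructor
      · rintro ⟨y, rfl⟩
        exact ⟨y.toMul.1, y.toMul.2, rfl⟩
      · rintro ⟨y, hy, hxy⟩
        exact ⟨Additive.ofMul ⟨y, hy⟩, Subtype.ext hxy⟩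
    rw [this, Subgroup.index_toAddSubgroup]
    rfl
  have e2 : Nat.card (nsmulAddMonoidHom (α := Additive H) 2).ker = 2 := by
    rw [Nat.card_eq_two_iff]
    have key : ∀ x : Additive H, x ∈ (nsmulAddMonoidHom (α := Additive H) 2).ker ↔
        (x.toMul : X) ^ 2 = 1 := by
      intro x
      rw [AddMonoidHom.mem_ker, nsmulAddMonoidHom_apply]
      constructor
      · intro hx
        exact congrArg (fun z : Additive H => (z.toMul : X)) hx
      · intro hx
        exact Subtype.ext hx
    refine ⟨⟨Additive.ofMul 1, (key _).2 (by simp)⟩, ⟨Additive.ofMul ⟨ε, hε⟩,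
      (key _).2 ((h2 _).2 (Or.inr rfl))⟩, ?_, ?_⟩
    · intro h
      exact hε1 (congrArg (fun z : (nsmulAddMonoidHom (α := Additive H) 2).ker =>
        (z.1.toMul : X)) h).symm
    · rw [Set.eq_univ_iff_forall]
      rintro ⟨x, hx⟩
      rcases (h2 _).1 ((key x).1 hx) with h | h
      · left; exact Subtype.ext (Subtype.ext h)
      · right; exact Subtype.ext (Subtype.ext h)
  rw [← e1, h, e2, pow_succ]

/-- Herbrand quotient of a finitely generated group with involution. -/
theorem herbrand {X : Type*} [CommGroup X] (σ : X →* X) (hσ : ∀ x, σ (σ x) = x) (E : Subgroup X)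
    (hE : ∀ x ∈ E, σ x ∈ E) [Module.Finite ℤ (Additive E)]
    (ε : X) (hε : ε ∈ E) (hεσ : σ ε = ε) (hε1 : ε ≠ 1) (h2 : ∀ x : X, x ^ 2 = 1 ↔ x = 1 ∨ x = ε)
    (hr : finrank ℤ (Additive E) = 2 * finrank ℤ (Additive (E ⊓ (del σ).ker : Subgroup X)) + 1) :
    (E.map (del σ)).relIndex (E ⊓ (nrm σ).ker) = 2 * (E.map (nrm σ)).relIndex (E ⊓ (del σ).ker) ∧
    (E.map (nrm σ)).relIndex (E ⊓ (del σ).ker) ≠ 0 ∧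
    ((E ⊓ (del σ).ker).map (powMonoidHom 2)).relIndex (E ⊓ (del σ).ker) =
      2 ^ (finrank ℤ (Additive (E ⊓ (del σ).ker : Subgroup X)) + 1) := by
  have hεε : ε * ε = 1 := by rw [← pow_two]; exact (h2 ε).2 (Or.inr rfl)
  set Ep : Subgroup X := E ⊓ (del σ).ker with hEp
  set Em : Subgroup X := E ⊓ (nrm σ).ker with hEm
  let s : E →* E := (σ.comp E.subtype).codRestrict E (fun x => hE x.1 x.2)
  let S : Additive E →ₗ[ℤ] Additive E := (MonoidHom.toAdditive s).toIntLinearMap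
  have hS : ∀ x, S (S x) = x := fun x => Subtype.ext (hσ _)
  have key := finrank_involution S hS
  let ep : LinearMap.ker (LinearMap.id - S) ≃+ Additive Ep :=
    { toFun := fun x => Additive.ofMul ⟨(x.1.toMul : X), x.1.toMul.2, by
        exact congrArg (fun z : Additive E => (z.toMul : X)) (LinearMap.mem_ker.1 x.2)⟩
      invFun := fun x => ⟨Additive.ofMul ⟨x.toMul.1, (Subgroup.mem_inf.1 x.toMul.2).1⟩, by
        apply LinearMap.mem_ker.2
        exact Subtype.ext (Subgroup.mem_inf.1 x.toMul.2).2⟩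
      left_inv := fun x => rfl
      right_inv := fun x => rfl
      map_add' := fun x y => rfl }
  let em : LinearMap.ker (LinearMap.id + S) ≃+ Additive Em :=
    { toFun := fun x => Additive.ofMul ⟨(x.1.toMul : X), x.1.toMul.2, by
        exact congrArg (fun z : Additive E => (z.toMul : X)) (LinearMap.mem_ker.1 x.2)⟩
      invFun := fun x => ⟨Additive.ofMul ⟨x.toMul.1, (Subgroup.mem_inf.1 x.toMul.2).1⟩, by
        apply LinearMap.mem_ker.2
        exact Subtype.ext (Subgroup.mem_inf.1 x.toMul.2).2⟩
      left_inv := fun x => rfl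
      right_inv := fun x => rfl
      map_add' := fun x y => rfl }
  rw [ep.toIntLinearEquiv.finrank_eq, em.toIntLinearEquiv.finrank_eq] at key
  have : Module.Finite ℤ (Additive Ep) := Module.Finite.equiv ep.toIntLinearEquiv
  have : Module.Finite ℤ (Additive Em) := Module.Finite.equiv em.toIntLinearEquiv
  have hp := relIndex_sq Ep ε (Subgroup.mem_inf.2 ⟨hε, (mem_del_ker _ _).2 hεσ⟩) hε1 h2
  have hm := relIndex_sq Em ε (Subgroup.mem_inf.2 ⟨hε, (mem_nrm_ker _ _).2 (by rw [hεσ, hεε])⟩)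
    hε1 h2
  have hrm : finrank ℤ (Additive Em) = finrank ℤ (Additive Ep) + 1 := by omega
  obtain ⟨h1, h2⟩ := herbrand_abstract σ hσ E hE
  rw [← hEp, ← hEm] at h1 h2
  refine ⟨?_, ?_, hp⟩
  · rw [h1] at hp
    rw [h2, hrm, pow_succ, ← hp] at hm
    have hne : (Ep ⊔ Em).relIndex E ≠ 0 := by
      intro h0
      rw [h0, zero_mul] at hp
      exact (pow_pos two_pos _).ne hp
    apply Nat.eq_of_mul_eq_mul_left (Nat.pos_of_ne_zero hne)
    rw [hm]; ring
  · intro h0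
    rw [h1, h0, mul_zero] at hp
    exact (pow_pos two_pos _).ne hp

end fg_groups

end Amb


namespace Amb

section combinatorics

variable {V W X : Type*} [CommGroup X]

/-- The group of divisors on a set `V`. -/
abbrev Dv (V : Type*) := Multiplicative (V →₀ ℤ)

/-- Action of a permutation on divisors. -/
noncomputable def tau (t : Equiv.Perm V) : Dv V →* Dv V :=
  AddMonoidHom.toMultiplicative (Finsupp.domCongr (M := ℤ) t.symm).toAddMonoidHom

lemma tau_apply (t : Equiv.Perm V) (c : Dv V) (v : V) :
    (tau t c).toAdd v = c.toAdd (t v) := rfl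

lemma Dv.ext {a b : Dv V} (h : ∀ v, a.toAdd v = b.toAdd v) : a = b :=
  Multiplicative.toAdd.injective (Finsupp.ext h)

lemma mul_app (a b : Dv V) (v : V) : (a * b).toAdd v = a.toAdd v + b.toAdd v := rfl
lemma div_app (a b : Dv V) (v : V) : (a / b).toAdd v = a.toAdd v - b.toAdd v := rfl
lemma one_app (v : V) : (1 : Dv V).toAdd v = 0 := rfl

lemma tau_tau (t : Equiv.Perm V) (ht : ∀ v, t (t v) = v) (c : Dv V) : tau t (tau t c) = c := by
  apply Dv.ext
  intro v
  rw [tau_apply, tau_apply, ht]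

lemma tau_h90 (t : Equiv.Perm V) (x : Dv V) (hx : x * tau t x = 1) :
    ∃ y, x = y / tau t y := by
  refine ⟨Multiplicative.ofAdd (x.toAdd.mapRange (fun n => max n 0) (by simp)), ?_⟩
  apply Dv.ext
  intro v
  have h := congrArg (fun z : Dv V => z.toAdd v) hx
  simp only [mul_app, one_app, tau_apply] at h
  rw [div_app, tau_apply]
  simp only [toAdd_ofAdd, Finsupp.mapRange_apply]
  omega

lemma even_mem_range (t : Equiv.Perm V) (π : V → W)
    (hπ : ∀ v v', π v = π v' ↔ v' = v ∨ v' = t v) (hπs : Function.Surjective π) (e : V → ℕ)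
    (he : ∀ v, e v = 1 ∨ (e v = 2 ∧ t v = v)) (J : Dv V) (hJ : tau t J = J)
    (h2 : ∀ v, e v = 2 → Even (J.toAdd v)) :
    ∃ c : W →₀ ℤ, ∀ v, J.toAdd v = e v * c (π v) := by
  classical
  choose g hg using hπs
  let m : W → ℤ := fun w => J.toAdd (g w) / e (g w)
  have hm : ∀ w, m w ≠ 0 → w ∈ J.toAdd.support.image π := by
    intro w hw
    rw [Finset.mem_image]
    refine ⟨g w, ?_, hg w⟩
    rw [Finsupp.mem_support_iff]
    intro h0
    apply hw
    simp [m, h0]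
  have het : ∀ v, e (t v) = e v := by
    intro v
    rcases he v with h | ⟨h, h'⟩
    · rcases he (t v) with h1 | ⟨h1, h1'⟩
      · rw [h, h1]
      · have := t.injective h1'
        rw [this]
    · rw [h']
  refine ⟨Finsupp.onFinset _ m hm, ?_⟩
  intro v
  rw [Finsupp.onFinset_apply]
  have hJt : J.toAdd (t v) = J.toAdd v := by rw [← tau_apply, hJ]
  have key : m (π v) = J.toAdd v / e v := by
    have h := (hπ v (g (π v))).1 (hg _).symm
    simp only [m]
    rcases h with h | h
    · rw [h]
    · rw [h, het, hJt]
  rw [key]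
  rcases he v with h | ⟨h, h'⟩
  · rw [h]; simp
  · have := h2 v h
    rw [h]
    push_cast
    exact (Int.mul_ediv_cancel' this.two_dvd).symm

variable (t : Equiv.Perm V) (ht : ∀ v, t (t v) = v) (π : V → W)
    (hπ : ∀ v v', π v = π v' ↔ v' = v ∨ v' = t v) (hπs : Function.Surjective π) (e : V → ℕ)
    (he : ∀ v, e v = 1 ∨ (e v = 2 ∧ t v = v)) (σ : X →* X) (f : X →* Dv V)
    (h1 : ∀ x, σ x = x → ∃ c : W →₀ ℤ, ∀ v, (f x).toAdd v = e v * c (π v))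
    (h2 : ∀ c : W →₀ ℤ, ∃ x, σ x = x ∧ ∀ v, (f x).toAdd v = e v * c (π v))

include hπ hπs he h1 h2

theorem index_fixed (hT : Finite {v // e v = 2}) :
    ((del σ).ker.map f).relIndex (del (tau t)).ker = 2 ^ Nat.card {v // e v = 2} := by
  classical
  let φ : Dv V →* ({v // e v = 2} → Multiplicative (ZMod 2)) :=
    { toFun := fun J v => Multiplicative.ofAdd ((J.toAdd v.1 : ℤ) : ZMod 2)
      map_one' := by ext v; simp [one_app]
      map_mul' := by
        intro a b
        ext v
        simp [mul_app] }
  have hφ : ∀ J, J ∈ φ.ker ↔ ∀ v, e v = 2 → Even (J.toAdd v) := by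
    intro J
    rw [MonoidHom.mem_ker, funext_iff]
    simp only [Subtype.forall]
    refine forall_congr' fun v => forall_congr' fun hv => ?_
    rw [← (ZMod.intCast_eq_zero_iff_even)]
    rfl
  have hker : (del σ).ker.map f = φ.ker ⊓ (del (tau t)).ker := by
    ext J
    constructor
    · rintro ⟨x, hx, rfl⟩
      obtain ⟨c, hc⟩ := h1 x ((mem_del_ker _ _).1 hx)
      refine Subgroup.mem_inf.2 ⟨(hφ _).2 ?_, (mem_del_ker _ _).2 ?_⟩
      · intro v hv
        rw [hc, hv]
        push_cast
        exact even_two_mul _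
      · apply Dv.ext
        intro v
        rw [tau_apply, hc, hc, (hπ v (t v)).2 (Or.inr rfl)]
        congr 1
        rcases he v with h | ⟨h, h'⟩
        · rcases he (t v) with h1 | ⟨h1, h1'⟩
          · rw [h, h1]
          · have := t.injective h1'
            rw [this]
        · rw [h']
    · intro hJ
      obtain ⟨ha, hb⟩ := Subgroup.mem_inf.1 hJ
      obtain ⟨c, hc⟩ := even_mem_range t π hπ hπs e he J ((mem_del_ker _ _).1 hb) ((hφ _).1 ha)
      obtain ⟨x, hx, hx'⟩ := h2 c
      refine ⟨x, (mem_del_ker _ _).2 hx, ?_⟩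
      apply Dv.ext
      intro v
      rw [hx', hc]
  rw [hker, Subgroup.inf_relIndex_right, Subgroup.relIndex_ker]
  have hsurj : (del (tau t)).ker.map φ = ⊤ := by
    rw [eq_top_iff]
    intro y _
    have : Fintype {v // e v = 2} := Fintype.ofFinite _
    let c : V → ℤ := fun v => if h : e v = 2 then ((y ⟨v, h⟩).toAdd.val : ℤ) else 0
    let J : Dv V := Multiplicative.ofAdd (Finsupp.onFinset
      (Finset.univ.image (Subtype.val : {v // e v = 2} → V)) c (by
        intro v hv
        rw [Finset.mem_image]
        by_cases h : e v = 2
        · exact ⟨⟨v, h⟩, Finset.mem_univ _, rfl⟩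
        · simp [c, h] at hv))
    have hJ : ∀ v, J.toAdd v = c v := fun v => rfl
    refine ⟨J, (mem_del_ker _ _).2 ?_, ?_⟩
    · apply Dv.ext
      intro v
      rw [tau_apply, hJ, hJ]
      rcases he v with h | ⟨h, h'⟩
      · rcases he (t v) with h1 | ⟨h1, h1'⟩
        · simp [c, h, h1]
        · have := t.injective h1'
          rw [this]
      · rw [h']
    · ext ⟨v, hv⟩
      change ((J.toAdd v : ℤ) : ZMod 2) = _
      rw [hJ]
      simp only [c, hv, dif_pos]
      simp
  rw [hsurj]
  have := Fintype.ofFinite {v // e v = 2}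
  rw [Subgroup.card_top, Nat.card_pi]
  have h : Nat.card (Multiplicative (ZMod 2)) = 2 := by
    rw [Nat.card_congr Multiplicative.toAdd]; simp
  simp [h]

theorem nrm_mem (J : Dv V) (ht : ∀ v, t (t v) = v) : J * tau t J ∈ f.range := by
  obtain ⟨c, hc⟩ := even_mem_range t π hπ hπs e he (J * tau t J) (by
    rw [map_mul, tau_tau t ht, mul_comm]) (by
    intro v hv
    have : t v = v := by
      rcases he v with h | h
      · omega
      · exact h.2
    rw [mul_app, tau_apply, this]
    exact ⟨_, rfl⟩)
  obtain ⟨x, -, hx'⟩ := h2 c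
  refine ⟨x, ?_⟩
  apply Dv.ext
  intro v
  rw [hx', hc]

omit hπ hπs he h1 h2 in
lemma relIndex_comap_sq {D : Type*} [CommGroup D] (P : Subgroup D) :
    P.relIndex (P.comap (powMonoidHom 2)) = Nat.card {c : D ⧸ P // c ^ 2 = 1} := by
  have h := Subgroup.relIndex_ker (K := P.comap (powMonoidHom 2)) (QuotientGroup.mk' P)
  rw [QuotientGroup.ker_mk'] at h
  rw [h]
  refine Nat.card_congr (Equiv.subtypeEquivRight ?_)
  intro c
  induction c using QuotientGroup.induction_on with
  | H z =>
    rw [← QuotientGroup.mk_pow, QuotientGroup.eq_one_iff]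
    constructor
    · rintro ⟨y, hy, hyz⟩
      have hy' : y ^ 2 ∈ P := hy
      have : y⁻¹ * z ∈ P := QuotientGroup.eq.1 hyz
      have h3 : z ^ 2 = y ^ 2 * (y⁻¹ * z) ^ 2 := by
        rw [← mul_pow]; simp
      rw [h3]
      exact mul_mem hy' (pow_mem this 2)
    · intro hz
      exact ⟨z, hz, rfl⟩

theorem index_A (ht : ∀ v, t (t v) = v) :
    f.range.relIndex (f.range.comap (del (tau t))) = Nat.card {c : Dv V ⧸ f.range // c ^ 2 = 1} := by
  rw [← relIndex_comap_sq]
  congr 1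
  ext J
  have h := nrm_mem t π hπ hπs e he σ f h1 h2 J ht
  rw [Subgroup.mem_comap, Subgroup.mem_comap, del_apply, powMonoidHom_apply]
  have h3 : J ^ 2 = (J * tau t J) * (J / tau t J) := by
    rw [mul_mul_div_cancel, pow_two]
  rw [h3, Subgroup.mul_mem_cancel_left _ h]

end combinatorics

end Amb


namespace Amb

section dedekind
open IsDedekindDomain FractionalIdeal nonZeroDivisors

variable (R F : Type*) [CommRing R] [IsDedekindDomain R] [Field F] [Algebra R F]
  [IsFractionRing R F]

/-- The divisor of a fractional ideal. -/
noncomputable def fracDv : (FractionalIdeal R⁰ F)ˣ →* Dv (HeightOneSpectrum R) where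
  toFun J := Multiplicative.ofAdd
    (Finsupp.ofSupportFinite (fun v => count F v (J : FractionalIdeal R⁰ F))
      (by
        have := finite_factors (R := R) (K := F) (J : FractionalIdeal R⁰ F)
        exact this))
  map_one' := by
    apply Dv.ext
    intro v
    exact count_one F v
  map_mul' a b := by
    apply Dv.ext
    intro v
    exact count_mul F v a.ne_zero b.ne_zero

lemma fracDv_apply (J : (FractionalIdeal R⁰ F)ˣ) (v : HeightOneSpectrum R) :
    (fracDv R F J).toAdd v = count F v (J : FractionalIdeal R⁰ F) := rfl

lemma fracDv_bijective : Function.Bijective (fracDv R F) := by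
  constructor
  · intro a b hab
    have h : ∀ v, count F v (a : FractionalIdeal R⁰ F) = count F v (b : FractionalIdeal R⁰ F) := by
      intro v
      rw [← fracDv_apply, ← fracDv_apply, hab]
    apply Units.ext
    rw [← finprod_heightOneSpectrum_factorization' F a.ne_zero,
      ← finprod_heightOneSpectrum_factorization' F b.ne_zero]
    simp_rw [h]
  · intro c
    have hne : ∀ v : HeightOneSpectrum R, (v.asIdeal : FractionalIdeal R⁰ F) ≠ 0 :=
      fun v => coeIdeal_ne_zero.mpr v.ne_bot
    have h0 : (c.toAdd.prod (fun v n => (v.asIdeal : FractionalIdeal R⁰ F) ^ n)) ≠ 0 := by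
      rw [Finsupp.prod, Finset.prod_ne_zero_iff]
      intro v _
      exact zpow_ne_zero _ (hne v)
    refine ⟨Units.mk0 _ h0, ?_⟩
    apply Dv.ext
    intro v
    rw [fracDv_apply]
    exact count_finsuppProd F v c.toAdd

/-- The divisor of an element. -/
noncomputable def dv : Fˣ →* Dv (HeightOneSpectrum R) := (fracDv R F).comp (toPrincipalIdeal R F)

lemma dv_apply (x : Fˣ) (v : HeightOneSpectrum R) :
    (dv R F x).toAdd v = count F v (spanSingleton R⁰ (x : F)) := by
  rw [dv, MonoidHom.comp_apply, fracDv_apply, coe_toPrincipalIdeal]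

lemma mem_dv_ker (x : Fˣ) :
    x ∈ (dv R F).ker ↔ ∃ u : Rˣ, algebraMap R F u = x := by
  have h1 : x ∈ (dv R F).ker ↔ toPrincipalIdeal R F x = 1 := by
    rw [MonoidHom.mem_ker, dv, MonoidHom.comp_apply, ← map_one (fracDv R F),
      (fracDv_bijective R F).1.eq_iff]
  rw [h1, toPrincipalIdeal_eq_iff, Units.val_one, ← spanSingleton_one, eq_comm]
  rw [spanSingleton_eq_spanSingleton]
  constructor
  · rintro ⟨u, hu⟩
    exact ⟨u, by rw [← hu, Units.smul_def, Algebra.smul_def, mul_one]⟩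
  · rintro ⟨u, hu⟩
    exact ⟨u, by rw [← hu, Units.smul_def, Algebra.smul_def, mul_one]⟩

/-- The class group as divisors modulo principal divisors. -/
noncomputable def clEquiv : ClassGroup R ≃* Dv (HeightOneSpectrum R) ⧸ (dv R F).range :=
  (ClassGroup.equiv F).trans
    (QuotientGroup.congr _ _ (MulEquiv.ofBijective (fracDv R F) (fracDv_bijective R F)) (by
      rw [dv, MonoidHom.range_comp]
      rfl))

variable {R}

lemma dv_mem_pow (x : Fˣ) (a : R) (hx : algebraMap R F a = x) (v : HeightOneSpectrum R) (n : ℕ) :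
    a ∈ v.asIdeal ^ n ↔ (n : ℤ) ≤ (dv R F x).toAdd v := by
  classical
  have ha : a ≠ 0 := by
    rintro rfl
    rw [map_zero] at hx
    exact x.ne_zero hx.symm
  have hs : Ideal.span {a} ≠ 0 := by simpa using ha
  rw [dv_apply, ← hx, ← coeIdeal_span_singleton, count_coe F v hs, Nat.cast_le,
    ← Ideal.dvd_span_singleton]
  rw [← Associates.prime_pow_dvd_iff_le (Associates.mk_ne_zero.2 hs) v.associates_irreducible,
    ← Associates.mk_pow, Associates.mk_le_mk_iff_dvd]

lemma dv_nonneg (x : Fˣ) (a : R) (hx : algebraMap R F a = x) (v : HeightOneSpectrum R) :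
    0 ≤ (dv R F x).toAdd v := by
  have := (dv_mem_pow F x a hx v 0).1 (by simp)
  simpa using this

/-- In a PID every divisor is principal. -/
lemma dv_surjective [IsPrincipalIdealRing R] : Function.Surjective (dv R F) := by
  intro c
  have : Subsingleton (ClassGroup R) := inferInstance
  have h2 : Subsingleton (Dv (HeightOneSpectrum R) ⧸ (dv R F).range) :=
    (clEquiv R F).symm.toEquiv.subsingleton
  rw [QuotientGroup.subsingleton_iff] at h2
  have : c ∈ (dv R F).range := by rw [h2]; trivial
  exact this

/-- Two integral elements have divisors matching if the power membership matches. -/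
lemma dv_eq_of_mem_pow {R' F' : Type*} [CommRing R'] [IsDedekindDomain R'] [Field F'] [Algebra R' F']
    [IsFractionRing R' F'] (x : Fˣ) (a : R) (hx : algebraMap R F a = x) (v : HeightOneSpectrum R)
    (x' : F'ˣ) (a' : R') (hx' : algebraMap R' F' a' = x') (v' : HeightOneSpectrum R')
    (h : ∀ n, a ∈ v.asIdeal ^ n ↔ a' ∈ v'.asIdeal ^ n) :
    (dv R F x).toAdd v = (dv R' F' x').toAdd v' := by
  have h1 : ∀ n : ℕ, (n : ℤ) ≤ (dv R F x).toAdd v ↔ (n : ℤ) ≤ (dv R' F' x').toAdd v' := by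
    intro n
    rw [← dv_mem_pow F x a hx v n, ← dv_mem_pow F' x' a' hx' v' n, h]
  have p1 := dv_nonneg F x a hx v
  have p2 := dv_nonneg F' x' a' hx' v'
  have q1 := (h1 ((dv R F x).toAdd v).toNat).1 (by omega)
  have q2 := (h1 ((dv R' F' x').toAdd v').toNat).2 (by omega)
  omega

lemma exists_div (x : Fˣ) : ∃ (a b : Fˣ) (a' b' : R), algebraMap R F a' = a ∧
    algebraMap R F b' = b ∧ x = a / b := by
  obtain ⟨a, b, hb, hab⟩ := IsFractionRing.div_surjective (A := R) (x : F)
  have hb0 : algebraMap R F b ≠ 0 := by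
    simpa using nonZeroDivisors.ne_zero hb
  have ha0 : algebraMap R F a ≠ 0 := by
    intro h
    rw [h, zero_div] at hab
    exact x.ne_zero hab.symm
  exact ⟨Units.mk0 _ ha0, Units.mk0 _ hb0, a, b, rfl, rfl, Units.ext (by simpa using hab.symm)⟩

end dedekind
end Amb


namespace Amb

set_option linter.unusedSectionVars false
section ext
open NumberField IsDedekindDomain

variable {K L : Type*} [Field K] [NumberField K] [Field L] [NumberField L] [Algebra K L]

/-- σ on the ring of integers. -/
noncomputable abbrev sO (σ : Gal(L/K)) : 𝓞 L ≃+* 𝓞 L := RingOfIntegers.mapRingEquiv σ.toRingEquiv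

/-- The permutation of the primes of `L` induced by `σ`. -/
noncomputable def tP (σ : Gal(L/K)) : Equiv.Perm (HeightOneSpectrum (𝓞 L)) :=
  HeightOneSpectrum.equivOfRingEquiv (sO σ).symm

lemma mem_tP (σ : Gal(L/K)) (v : HeightOneSpectrum (𝓞 L)) (x : 𝓞 L) :
    x ∈ (tP σ v).asIdeal ↔ sO σ x ∈ v.asIdeal := Iff.rfl

lemma mem_tP_pow (σ : Gal(L/K)) (v : HeightOneSpectrum (𝓞 L)) (x : 𝓞 L) (n : ℕ) :
    x ∈ (tP σ v).asIdeal ^ n ↔ sO σ x ∈ v.asIdeal ^ n := by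
  have h : (tP σ v).asIdeal = v.asIdeal.map (sO σ).symm := by
    ext x
    rw [mem_tP, ← Ideal.comap_symm, RingEquiv.symm_symm]
    rfl
  rw [h, ← Ideal.map_pow, ← Ideal.comap_symm, RingEquiv.symm_symm]
  rfl

/-- σ on the units. -/
noncomputable def sU (σ : Gal(L/K)) : Lˣ →* Lˣ := Units.map (σ : L →* L)

lemma sU_coe (σ : Gal(L/K)) (x : Lˣ) : ((sU σ x : Lˣ) : L) = σ x := rfl

lemma dv_sU (σ : Gal(L/K)) (x : Lˣ) : dv (𝓞 L) L (sU σ x) = tau (tP σ) (dv (𝓞 L) L x) := by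
  have key : ∀ (a : 𝓞 L) (y : Lˣ), algebraMap (𝓞 L) L a = y →
      dv (𝓞 L) L (sU σ y) = tau (tP σ) (dv (𝓞 L) L y) := by
    intro a y hy
    apply Dv.ext
    intro v
    rw [tau_apply]
    refine dv_eq_of_mem_pow L (sU σ y) (sO σ a) ?_ v y a hy (tP σ v) ?_
    · rw [sU_coe, ← hy]
      rfl
    · intro n
      exact (mem_tP_pow σ v a n).symm
  obtain ⟨a, b, a', b', ha, hb, rfl⟩ := exists_div (R := 𝓞 L) L x
  rw [map_div, map_div, map_div, map_div, key _ _ ha, key _ _ hb]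

/-- The prime of `K` below. -/
noncomputable def pP (v : HeightOneSpectrum (𝓞 L)) : HeightOneSpectrum (𝓞 K) :=
  HeightOneSpectrum.under (𝓞 K) v

lemma pP_asIdeal (v : HeightOneSpectrum (𝓞 L)) :
    (pP (K := K) v).asIdeal = v.asIdeal.under (𝓞 K) := rfl

instance (v : HeightOneSpectrum (𝓞 L)) : v.asIdeal.LiesOver (pP (K := K) v).asIdeal := ⟨rfl⟩

lemma pP_surjective : Function.Surjective (pP (K := K) (L := L)) := by
  intro q
  obtain ⟨⟨Q, hQ, hQo⟩⟩ := Ideal.nonempty_primesOver (S := 𝓞 L) q.asIdeal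
  refine ⟨⟨Q, hQ, ?_⟩, ?_⟩
  · rintro rfl
    apply q.ne_bot
    rw [hQo.over]
    exact Ideal.under_bot _ _
  · ext1
    exact hQo.over.symm

variable (K) in
/-- ramification index -/
noncomputable def eR (v : HeightOneSpectrum (𝓞 L)) : ℕ := v.asIdeal.ramificationIdx (𝓞 K)

/-- the inclusion of units -/
noncomputable abbrev iU : Kˣ →* Lˣ := Units.map (algebraMap K L : K →* L)

lemma dv_iU [IsPrincipalIdealRing (𝓞 K)] (x : Kˣ) (v : HeightOneSpectrum (𝓞 L)) :
    (dv (𝓞 L) L (iU x)).toAdd v = eR K v * (dv (𝓞 K) K x).toAdd (pP v) := by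
  have hmap : ∀ a : 𝓞 K, algebraMap (𝓞 L) L (algebraMap (𝓞 K) (𝓞 L) a) = algebraMap K L a := by
    intro a
    rfl
  set q := pP (K := K) v with hq
  obtain ⟨π, hπ⟩ : ∃ π, q.asIdeal = Ideal.span {π} :=
    (IsPrincipalIdealRing.principal q.asIdeal).principal
  have hπ0 : algebraMap (𝓞 K) K π ≠ 0 := by
    intro h
    apply q.ne_bot
    rw [hπ]
    simpa using h
  -- value at the uniformizer
  have hval : (dv (𝓞 L) L (iU (Units.mk0 _ hπ0))).toAdd v = eR K v := by
    have h1 : ∀ n : ℕ, (n : ℤ) ≤ (dv (𝓞 L) L (iU (Units.mk0 _ hπ0))).toAdd v ↔ n ≤ eR K v := by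
      intro n
      rw [← dv_mem_pow L (iU (Units.mk0 _ hπ0)) (algebraMap (𝓞 K) (𝓞 L) π) (hmap π) v n]
      have hne : q.asIdeal.map (algebraMap (𝓞 K) (𝓞 L)) ≠ ⊥ := Ideal.map_ne_bot_of_ne_bot q.ne_bot
      have : v.asIdeal.LiesOver q.asIdeal := ⟨rfl⟩
      rw [eR, Ideal.IsDedekindDomain.ramificationIdx_eq_multiplicity q.asIdeal v.asIdeal hne,
        ← FiniteMultiplicity.pow_dvd_iff_le_multiplicity
          (FiniteMultiplicity.of_prime_left v.prime hne), hπ, Ideal.map_span, Set.image_singleton,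
        Ideal.dvd_span_singleton]
    have p1 := dv_nonneg L (iU (Units.mk0 _ hπ0)) (algebraMap (𝓞 K) (𝓞 L) π) (hmap π) v
    have q1 := (h1 ((dv (𝓞 L) L (iU (Units.mk0 _ hπ0))).toAdd v).toNat).1 (by omega)
    have q2 := (h1 (eR K v)).2 le_rfl
    omega
  have key : ∀ (a : 𝓞 K) (y : Kˣ), algebraMap (𝓞 K) K a = y →
      (dv (𝓞 L) L (iU y)).toAdd v = eR K v * (dv (𝓞 K) K y).toAdd q := by
    intro a y hy
    have hn0 := dv_nonneg K y a hy q
    obtain ⟨n, hn⟩ := Int.eq_ofNat_of_zero_le hn0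
    have h1 : a ∈ q.asIdeal ^ n := (dv_mem_pow K y a hy q n).2 hn.ge
    have h2 : a ∉ q.asIdeal ^ (n + 1) := by
      rw [dv_mem_pow K y a hy q (n + 1), hn]
      push_cast
      omega
    rw [hπ, Ideal.span_singleton_pow, Ideal.mem_span_singleton] at h1 h2
    obtain ⟨b, hb⟩ := h1
    have hbq : b ∉ q.asIdeal := by
      rw [hπ, Ideal.mem_span_singleton]
      rintro ⟨c, rfl⟩
      exact h2 ⟨c, by rw [hb]; ring⟩
    have hb0 : algebraMap (𝓞 K) K b ≠ 0 := by
      intro h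
      have : b = 0 := by simpa using h
      rw [this] at hbq
      exact hbq (zero_mem _)
    have hyy : y = (Units.mk0 _ hπ0) ^ n * Units.mk0 _ hb0 := by
      apply Units.ext
      rw [← hy, hb]
      simp
    have hb1 : (dv (𝓞 L) L (iU (Units.mk0 _ hb0))).toAdd v = 0 := by
      have p1 := dv_nonneg L (iU (Units.mk0 _ hb0)) (algebraMap (𝓞 K) (𝓞 L) b) (hmap b) v
      by_contra hne
      have := (dv_mem_pow L (iU (Units.mk0 _ hb0)) (algebraMap (𝓞 K) (𝓞 L) b) (hmap b) v 1).2 (by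
        push_cast
        omega)
      rw [pow_one] at this
      exact hbq this
    rw [hn, hyy, map_mul, map_mul, mul_app, hb1, map_pow, map_pow, add_zero, toAdd_pow,
      Finsupp.smul_apply, hval]
    simp [mul_comm]
  obtain ⟨a, b, a', b', ha, hb, rfl⟩ := exists_div (R := 𝓞 K) K x
  rw [map_div (iU (K := K) (L := L)), map_div (dv (𝓞 L) L), map_div (dv (𝓞 K) K), div_app, div_app, key _ _ ha, key _ _ hb]
  ring

section gal
variable (σ : Gal(L/K)) (hσ : ∀ g : Gal(L/K), g = 1 ∨ g = σ) (hσ2 : ∀ x, σ (σ x) = x)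
  [IsGalois K L]

include hσ2 in
omit [IsGalois K L] in
lemma tP_tP (v : HeightOneSpectrum (𝓞 L)) : tP σ (tP σ v) = v := by
  ext x
  rw [mem_tP, mem_tP]
  have : sO σ (sO σ x) = x := by
    apply RingOfIntegers.ext
    exact hσ2 x
  rw [this]

include hσ hσ2 in
lemma pP_eq_iff (v v' : HeightOneSpectrum (𝓞 L)) :
    pP (K := K) v = pP v' ↔ v' = v ∨ v' = tP σ v := by
  constructor
  · intro h
    have h' : v.asIdeal.under (𝓞 K) = v'.asIdeal.under (𝓞 K) := congrArg (·.asIdeal) h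
    obtain ⟨g, hg⟩ := Algebra.IsInvariant.exists_smul_of_under_eq (𝓞 K) (𝓞 L) Gal(L/K) _ _ h'
    rcases hσ g with rfl | rfl
    · left
      ext1
      rw [hg, one_smul]
    · right
      have hinv : g⁻¹ = g := inv_eq_of_mul_eq_one_right (by ext x; exact hσ2 x)
      ext x
      rw [hg, Ideal.mem_pointwise_smul_iff_inv_smul_mem, hinv, mem_tP]
      rfl
  · rintro (rfl | rfl)
    · rfl
    · ext x
      rw [pP_asIdeal, pP_asIdeal, Ideal.mem_comap, Ideal.mem_comap, mem_tP]
      have : sO σ (algebraMap (𝓞 K) (𝓞 L) x) = algebraMap (𝓞 K) (𝓞 L) x := by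
        apply RingOfIntegers.ext
        exact σ.commutes (x : K)
      rw [this]

include hσ hσ2 in
lemma eR_cases (hcard : Nat.card Gal(L/K) = 2) (v : HeightOneSpectrum (𝓞 L)) :
    eR K v = 1 ∨ (eR K v = 2 ∧ tP σ v = v) := by
  have h := Ideal.ncard_primesOver_mul_ramificationIdxIn_mul_inertiaDegIn (pP (K := K) v).asIdeal
    (𝓞 L) Gal(L/K)
  rw [Ideal.ramificationIdxIn_eq_ramificationIdx _ v.asIdeal Gal(L/K), hcard] at h
  change _ * (eR K v * _) = 2 at h
  have hd : eR K v ∣ 2 := 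
    ⟨((pP (K := K) v).asIdeal.primesOver (𝓞 L)).ncard * (pP (K := K) v).asIdeal.inertiaDegIn (𝓞 L),
      by rw [← h]; ring⟩
  rcases (Nat.dvd_prime Nat.prime_two).1 hd with h1 | h1
  · exact Or.inl h1
  · right
    refine ⟨h1, ?_⟩
    rw [h1] at h
    have h3 : ((pP (K := K) v).asIdeal.primesOver (𝓞 L)).ncard = 1 := by
      have : ((pP (K := K) v).asIdeal.primesOver (𝓞 L)).ncard ∣ 1 := by
        refine ⟨(pP (K := K) v).asIdeal.inertiaDegIn (𝓞 L), ?_⟩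
        nlinarith
      exact Nat.dvd_one.1 this
    obtain ⟨Q, hQ⟩ := Set.ncard_eq_one.1 h3
    have e1 : v.asIdeal ∈ (pP (K := K) v).asIdeal.primesOver (𝓞 L) := ⟨v.isPrime, ⟨rfl⟩⟩
    have e2 : (tP σ v).asIdeal ∈ (pP (K := K) v).asIdeal.primesOver (𝓞 L) := by
      rw [(pP_eq_iff σ hσ hσ2 v (tP σ v)).2 (Or.inr rfl)]
      exact ⟨(tP σ v).isPrime, ⟨rfl⟩⟩
    rw [hQ] at e1 e2
    ext1
    rw [Set.mem_singleton_iff.1 e1, Set.mem_singleton_iff.1 e2]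

end gal

end ext
end Amb


namespace Amb

set_option linter.unusedSectionVars false
section mainformula
open NumberField IsDedekindDomain Module

variable {K L : Type*} [Field K] [NumberField K] [Field L] [NumberField L] [Algebra K L]

/-- units of the ring of integers inside the units of the field -/
noncomputable def gE (F : Type*) [Field F] : (𝓞 F)ˣ →* Fˣ := Units.map (algebraMap (𝓞 F) F : 𝓞 F →* F)

lemma gE_injective (F : Type*) [Field F] [NumberField F] : Function.Injective (gE F) :=
  Units.map_injective RingOfIntegers.coe_injective

lemma gE_range (F : Type*) [Field F] [NumberField F] : (gE F).range = (dv (𝓞 F) F).ker := by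
  ext x
  rw [mem_dv_ker]
  constructor
  · rintro ⟨u, rfl⟩
    exact ⟨u, rfl⟩
  · rintro ⟨u, hu⟩
    exact ⟨u, Units.ext hu⟩

lemma iU_injective : Function.Injective (iU (K := K) (L := L)) :=
  Units.map_injective (algebraMap K L).injective

variable (σ : Gal(L/K)) (hσ : ∀ g : Gal(L/K), g = 1 ∨ g = σ) (hσ2 : ∀ x, σ (σ x) = x)
  [IsGalois K L]

include hσ in
lemma fixed_iff (x : L) : σ x = x ↔ ∃ k : K, algebraMap K L k = x := by
  constructor
  · intro h
    have := (IsGalois.mem_bot_iff_fixed (F := K) (E := L) x).2 (by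
      intro f
      rcases hσ f with rfl | rfl
      · rfl
      · exact h)
    exact IntermediateField.mem_bot.1 this
  · rintro ⟨k, rfl⟩
    exact σ.commutes k

include hσ in
lemma fixedU_iff (x : Lˣ) : sU σ x = x ↔ ∃ k : Kˣ, iU k = x := by
  constructor
  · intro h
    obtain ⟨k, hk⟩ := (fixed_iff σ hσ (x : L)).1 (by rw [← sU_coe, h])
    have hk0 : k ≠ 0 := by
      rintro rfl
      rw [map_zero] at hk
      exact x.ne_zero hk.symm
    exact ⟨Units.mk0 k hk0, Units.ext hk⟩
  · rintro ⟨k, rfl⟩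
    apply Units.ext
    exact σ.commutes (k : K)

include hσ in
lemma Ep_eq : (dv (𝓞 L) L).ker ⊓ (del (sU σ)).ker = ((iU (K := K) (L := L)).comp (gE K)).range := by
  ext x
  rw [Subgroup.mem_inf, mem_del_ker, fixedU_iff σ hσ, mem_dv_ker]
  constructor
  · rintro ⟨⟨u, hu⟩, ⟨k, hk⟩⟩
    have h1 : IsIntegral ℤ (k : K) := by
      rw [← isIntegral_algebraMap_iff (algebraMap K L).injective]
      have : algebraMap K L k = algebraMap (𝓞 L) L u := by
        rw [hu, ← hk]; rfl
      rw [this]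
      exact RingOfIntegers.isIntegral_coe _
    have h2 : IsIntegral ℤ ((k⁻¹ : Kˣ) : K) := by
      rw [← isIntegral_algebraMap_iff (algebraMap K L).injective]
      have : algebraMap K L ((k⁻¹ : Kˣ) : K) = algebraMap (𝓞 L) L ((u⁻¹ : (𝓞 L)ˣ) : 𝓞 L) := by
        have e1 : (algebraMap (𝓞 L) L ((u⁻¹ : (𝓞 L)ˣ) : 𝓞 L)) = ((gE L u)⁻¹ : Lˣ) := by
          rw [← map_inv]; rfl
        have e2 : gE L u = iU k := by
          apply Units.ext
          rw [hk]
          exact hu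
        rw [e1, e2, ← map_inv]
        rfl
      rw [this]
      exact RingOfIntegers.isIntegral_coe _
    refine ⟨⟨⟨k, h1⟩, ⟨_, h2⟩, ?_, ?_⟩, ?_⟩
    · apply RingOfIntegers.ext
      exact k.mul_inv
    · apply RingOfIntegers.ext
      exact k.inv_mul
    · rw [← hk]
      rfl
  · rintro ⟨u, rfl⟩
    refine ⟨⟨Units.map (algebraMap (𝓞 K) (𝓞 L) : 𝓞 K →* 𝓞 L) u, rfl⟩, ⟨gE K u, rfl⟩⟩

lemma finrank_subgroup_of_range {A B : Type*} [CommGroup A] [CommGroup B] (f : A →* B)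
    (hf : Function.Injective f) (H : Subgroup B) (hH : f.range = H) [Module.Finite ℤ (Additive A)] :
    Module.Finite ℤ (Additive H) ∧ finrank ℤ (Additive H) = finrank ℤ (Additive A) := by
  subst hH
  let e : Additive A ≃ₗ[ℤ] Additive f.range := (MulEquiv.toAdditive (MonoidHom.ofInjective hf)).toIntLinearEquiv
  exact ⟨Module.Finite.equiv e, e.finrank_eq.symm⟩

/-- The units of `K` which are norms from `L`. -/
noncomputable def normUnits : Subgroup (𝓞 K)ˣ :=
  (nrm (sU σ)).range.comap ((iU (K := K) (L := L)).comp (gE K))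

lemma mem_normUnits (u : (𝓞 K)ˣ) :
    u ∈ normUnits σ ↔ ∃ x : L, x * σ x = algebraMap K L (u : 𝓞 K) := by
  constructor
  · rintro ⟨x, hx⟩
    exact ⟨x, congrArg Units.val hx⟩
  · rintro ⟨x, hx⟩
    have hx0 : x ≠ 0 := by
      rintro rfl
      rw [zero_mul] at hx
      have h1 : ((u : 𝓞 K) : K) = 0 := by
        apply (algebraMap K L).injective
        rw [← hx, map_zero]
      exact u.ne_zero (RingOfIntegers.ext h1)
    exact ⟨Units.mk0 x hx0, Units.ext hx⟩

include hσ hσ2 in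
theorem main_formula [IsPrincipalIdealRing (𝓞 K)] (hcard : Nat.card Gal(L/K) = 2)
    (s : L) (hs0 : s ≠ 0) (hss : σ s = -s) (hrK : Units.rank K = 1) (hrL : Units.rank L = 3)
    (hT : Finite {v : HeightOneSpectrum (𝓞 L) // eR K v = 2}) :
    Nat.card {c : ClassGroup (𝓞 L) // c ^ 2 = 1} * (2 * (normUnits σ).index) =
      2 ^ Nat.card {v : HeightOneSpectrum (𝓞 L) // eR K v = 2} ∧
    (powMonoidHom 2 : (𝓞 K)ˣ →* (𝓞 K)ˣ).range.index = 4 := by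
  set f := dv (𝓞 L) L with hf
  set S := sU σ with hS
  have hSS : ∀ x, S (S x) = x := fun x => Units.ext (hσ2 x)
  have htt := tP_tP σ hσ2
  have h1 : ∀ x, S x = x → ∃ c : HeightOneSpectrum (𝓞 K) →₀ ℤ, ∀ v, (f x).toAdd v = eR K v * c (pP v) := by
    intro x hx
    obtain ⟨k, rfl⟩ := (fixedU_iff σ hσ x).1 hx
    exact ⟨(dv (𝓞 K) K k).toAdd, fun v => dv_iU k v⟩
  have h2 : ∀ c : HeightOneSpectrum (𝓞 K) →₀ ℤ, ∃ x, S x = x ∧ ∀ v, (f x).toAdd v = eR K v * c (pP v) := by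
    intro c
    obtain ⟨k, hk⟩ := dv_surjective (R := 𝓞 K) K (Multiplicative.ofAdd c)
    refine ⟨iU k, (fixedU_iff σ hσ _).2 ⟨k, rfl⟩, fun v => ?_⟩
    rw [hf, dv_iU, hk]
    rfl
  have h90 : ∀ x, x * S x = 1 → ∃ y, x = y / S y := by
    intro x hx
    have hx' : (x : L) * σ x = 1 := congrArg Units.val hx
    by_cases hx1 : (x : L) = -1
    · refine ⟨Units.mk0 s hs0, Units.ext ?_⟩
      rw [Units.val_div_eq_div_val, hS, sU_coe, Units.val_mk0, hss, hx1, div_neg, div_self hs0]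
    · have h0 : (1 : L) + x ≠ 0 := by
        intro h
        exact hx1 (by linear_combination h)
      refine ⟨Units.mk0 _ h0, ?_⟩
      rw [eq_div_iff_mul_eq']
      apply Units.ext
      rw [Units.val_mul, hS, sU_coe, Units.val_mk0, map_add, map_one]
      linear_combination hx'
  have hA := ambiguous_abstract S (tau (tP σ)) f hSS (tau_tau _ htt) (dv_sU σ) h90
    (fun x hx => tau_h90 (tP σ) x hx)
  rw [index_A (tP σ) pP (pP_eq_iff σ hσ hσ2) pP_surjective (eR K) (eR_cases σ hσ hσ2 hcard) S f h1 h2 htt,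
    index_fixed (tP σ) pP (pP_eq_iff σ hσ hσ2) pP_surjective (eR K) (eR_cases σ hσ hσ2 hcard) S f h1 h2 hT] at hA
  have hcl : Nat.card {c : Dv (HeightOneSpectrum (𝓞 L)) ⧸ f.range // c ^ 2 = 1} =
      Nat.card {c : ClassGroup (𝓞 L) // c ^ 2 = 1} := by
    refine Nat.card_congr ((clEquiv (𝓞 L) L).symm.toEquiv.subtypeEquiv ?_)
    intro a
    change a ^ 2 = 1 ↔ ((clEquiv (𝓞 L) L).symm a) ^ 2 = 1
    rw [← map_pow, map_eq_one_iff _ (clEquiv (𝓞 L) L).symm.injective]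
  rw [hcl] at hA
  have hEp := Ep_eq (K := K) σ hσ
  have hginj : Function.Injective ((iU (K := K) (L := L)).comp (gE K)) :=
    iU_injective.comp (gE_injective K)
  obtain ⟨fin1, fr1⟩ := finrank_subgroup_of_range (gE L) (gE_injective L) f.ker (gE_range L)
  obtain ⟨fin2, fr2⟩ := finrank_subgroup_of_range ((iU (K := K) (L := L)).comp (gE K)) hginj
    (f.ker ⊓ (del S).ker) hEp.symm
  rw [Units.finrank_eq, hrL] at fr1
  rw [Units.finrank_eq, hrK] at fr2
  have hne : (-1 : Lˣ) ≠ 1 := by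
    intro h
    have := congrArg Units.val h
    norm_num at this
  have hsq : ∀ x : Lˣ, x ^ 2 = 1 ↔ x = 1 ∨ x = -1 := by
    intro x
    rw [Units.ext_iff, Units.ext_iff, Units.ext_iff, Units.val_pow_eq_pow_val]
    simp
  obtain ⟨q1, q2, q3⟩ := herbrand S hSS f.ker (by
    intro x hx
    rw [MonoidHom.mem_ker] at hx ⊢
    rw [hf, hS, dv_sU, ← hf, hx, map_one]) (-1) (by
      rw [hf, mem_dv_ker]
      exact ⟨-1, by simp⟩) (by
      apply Units.ext
      rw [hS, sU_coe]
      simp) hne hsq (by rw [fr1, fr2])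
  rw [fr2] at q3
  rw [q1] at hA
  have hle1 : f.ker.map (nrm S) ≤ f.ker ⊓ (nrm S).range := by
    rintro _ ⟨x, hx, rfl⟩
    refine ⟨?_, ⟨x, rfl⟩⟩
    have hx' : f x = 1 := hx
    change f (x * S x) = 1
    rw [map_mul, hx', hS, hf, dv_sU, ← hf, hx', map_one, one_mul]
  have hle2 : f.ker ⊓ (nrm S).range ≤ f.ker ⊓ (del S).ker := by
    refine inf_le_inf_left _ ?_
    rintro _ ⟨x, rfl⟩
    rw [mem_del_ker, nrm_apply, map_mul, hSS, mul_comm]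
  have hmul := Subgroup.relIndex_mul_relIndex _ _ _ hle1 hle2
  have hidx : (f.ker ⊓ (nrm S).range).relIndex (f.ker ⊓ (del S).ker) = (normUnits σ).index := by
    rw [normUnits, Subgroup.index_comap, ← hEp]
    have : f.ker ⊓ (nrm S).range = (nrm S).range ⊓ (f.ker ⊓ (del S).ker) := by
      apply le_antisymm
      · exact le_inf inf_le_right hle2
      · exact le_inf (inf_le_right.trans inf_le_left) inf_le_left
    rw [this, Subgroup.inf_relIndex_right]
  rw [hidx] at hmul
  constructor
  · rw [← hmul] at hA q2
    have hq2 := left_ne_zero_of_mul q2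
    apply Nat.eq_of_mul_eq_mul_right (Nat.pos_of_ne_zero hq2)
    rw [← hA]
    ring
  · have h4 : (powMonoidHom 2 : (𝓞 K)ˣ →* (𝓞 K)ˣ).range.index =
        ((f.ker ⊓ (del S).ker).map (powMonoidHom 2)).relIndex (f.ker ⊓ (del S).ker) := by
      rw [hEp]
      set g := (iU (K := K) (L := L)).comp (gE K)
      have : g.range.map (powMonoidHom 2) = (powMonoidHom 2 : (𝓞 K)ˣ →* (𝓞 K)ˣ).range.map g := by
        ext x
        constructor
        · rintro ⟨_, ⟨y, rfl⟩, rfl⟩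
          exact ⟨y ^ 2, ⟨y, rfl⟩, by simp⟩
        · rintro ⟨_, ⟨y, rfl⟩, rfl⟩
          exact ⟨g y, ⟨y, rfl⟩, by simp⟩
      rw [this, MonoidHom.range_eq_map g, Subgroup.relIndex_map_map_of_injective _ _ hginj,
        Subgroup.relIndex_top_right]
    rw [h4, q3]
    norm_num

end mainformula
end Amb


namespace Amb

set_option linter.unusedSectionVars false
section cyc
open NumberField IsDedekindDomain Module

variable (K : Type*) [Field K] [NumberField K] [hK : IsCyclotomicExtension {8} ℚ K]

include hK in
lemma K_finrank : finrank ℚ K = 4 := by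
  rw [IsCyclotomicExtension.finrank (n := 8) K (Polynomial.cyclotomic.irreducible_rat (by simp))]
  decide

include hK in
lemma K_complex : IsTotallyComplex K := IsCyclotomicExtension.Rat.isTotallyComplex (n := 8) K (by simp)

lemma rank_complex (F : Type*) [Field F] [NumberField F] [IsTotallyComplex F] :
    Units.rank F = finrank ℚ F / 2 - 1 := by
  rw [Units.rank, InfinitePlace.card_eq_nrRealPlaces_add_nrComplexPlaces,
    IsTotallyComplex.nrRealPlaces_eq_zero, IsTotallyComplex.finrank]
  omega

include hK in
lemma K_rank : Units.rank K = 1 := by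
  have := K_complex K
  rw [rank_complex, K_finrank]

include hK in
lemma K_pid : IsPrincipalIdealRing (𝓞 K) := by
  have h8 : IsCyclotomicExtension {2 ^ (2 + 1)} ℚ K := hK
  have hGal : IsGalois ℚ K := IsCyclotomicExtension.isGalois {8} ℚ K
  have hf : Fact (Nat.Prime 2) := ⟨Nat.prime_two⟩
  have hdisc : NumberField.discr K = 256 := by
    rw [IsCyclotomicExtension.Rat.discr_prime_pow_succ 2 2 K]
    norm_num
  apply RingOfIntegers.isPrincipalIdealRing_of_isPrincipal_of_lt_or_isPrincipal_of_mem_primesOver_of_mem_Icc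
  intro p hp hpp
  have hlt : ⌊(4 / Real.pi) ^ InfinitePlace.nrComplexPlaces K *
      (((finrank ℚ K).factorial : ℝ) / (finrank ℚ K) ^ (finrank ℚ K) * √|(discr K : ℤ)|)⌋₊ < 3 := by
    rw [Nat.floor_lt (by positivity), hdisc, K_finrank,
      IsCyclotomicExtension.Rat.nrComplexPlaces_eq_totient_div_two 8]
    have h1 : Nat.totient 8 / 2 = 2 := by decide
    have h2 : √|((256 : ℤ) : ℝ)| = 16 := by
      rw [show |((256 : ℤ) : ℝ)| = 16 ^ 2 by norm_num]
      exact Real.sqrt_sq (by norm_num)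
    have h3 : (4 / Real.pi) ^ 2 < (4 / 3) ^ 2 := by
      have := Real.pi_gt_three
      gcongr
    rw [h1, h2]
    norm_num [Nat.factorial] at h3 ⊢
    linarith
  have hp2 : p = 2 := by
    have h1 := (Finset.mem_Icc.1 hp).2
    have h2 := hpp.two_le
    have := lt_of_le_of_lt h1 hlt
    omega
  subst hp2
  have hζ := IsCyclotomicExtension.zeta_spec (2 ^ (2 + 1)) ℚ K
  refine ⟨Ideal.span {hζ.toInteger - 1}, ⟨IsCyclotomicExtension.Rat.isPrime_span_zeta_sub_one 2 2 hζ,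
    IsCyclotomicExtension.Rat.liesOver_span_zeta_sub_one 2 2 hζ⟩, Or.inr ⟨⟨_, rfl⟩⟩⟩

section primes
variable (p : ℕ) [hp : Fact p.Prime] (hp8 : p % 8 = 3)

include hp8

lemma p_not_dvd : ¬ p ∣ 8 := by
  intro h
  have h2 : p ∣ 2 ^ 3 := h
  have := (Nat.prime_dvd_prime_iff_eq hp.out Nat.prime_two).1 (hp.out.dvd_of_dvd_pow h2)
  omega

lemma p_order : orderOf (p : ZMod 8) = 2 := by
  have : (p : ZMod 8) = 3 := by
    have := ZMod.natCast_mod p 8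
    rw [hp8] at this
    exact this.symm
  rw [this]
  exact orderOf_eq_prime (by decide) (by decide)

include hK in
lemma ncard_primesOver : ((Ideal.span {(p : ℤ)}).primesOver (𝓞 K)).ncard = 2 := by
  have hGal : IsGalois ℚ K := IsCyclotomicExtension.isGalois {8} ℚ K
  have h := Ideal.ncard_primesOver_mul_ramificationIdxIn_mul_inertiaDegIn (Ideal.span {(p : ℤ)})
    (𝓞 K) Gal(K/ℚ)
  rw [IsCyclotomicExtension.Rat.ramificationIdxIn_eq_of_not_dvd (m := 8) p K (p_not_dvd p hp8),
    IsCyclotomicExtension.Rat.inertiaDegIn_eq_of_not_dvd (m := 8) p K (p_not_dvd p hp8), p_order p hp8,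
    IsGalois.card_aut_eq_finrank, K_finrank] at h
  omega

variable {K} (q : HeightOneSpectrum (𝓞 K)) (hq : (p : 𝓞 K) ∈ q.asIdeal)

omit hp8 hK in
include hq in
lemma lies_over : q.asIdeal.LiesOver (Ideal.span {(p : ℤ)}) := by
  constructor
  have : (Ideal.span {(p : ℤ)}).IsMaximal := Int.ideal_span_isMaximal_of_prime p
  refine this.eq_of_le (Ideal.IsPrime.under ℤ q.asIdeal).ne_top ?_
  rw [Ideal.span_singleton_le_iff_mem, Ideal.mem_comap]
  simpa using hq

include hK hq
lemma card_residue : Nat.card (𝓞 K ⧸ q.asIdeal) = p ^ 2 := by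
  have := lies_over p q hq
  have h := IsCyclotomicExtension.Rat.inertiaDeg_eq_of_not_dvd (m := 8) p K q.asIdeal (p_not_dvd p hp8)
  rw [p_order p hp8] at h
  have h2 : p ^ q.asIdeal.inertiaDeg ℤ = Ideal.absNorm q.asIdeal := Ideal.pow_inertiaDeg p q.asIdeal
  rw [h] at h2
  rw [h2]
  rfl

lemma not_mem_sq : (p : 𝓞 K) ∉ q.asIdeal ^ 2 := by
  have := lies_over p q hq
  have h := IsCyclotomicExtension.Rat.ramificationIdx_eq_of_not_dvd (m := 8) p K q.asIdeal (p_not_dvd p hp8)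
  have hne : (Ideal.span {(p : ℤ)}).map (algebraMap ℤ (𝓞 K)) ≠ ⊥ := by
    apply Ideal.map_ne_bot_of_ne_bot
    simpa using hp.out.ne_zero
  rw [Ideal.IsDedekindDomain.ramificationIdx_eq_multiplicity _ q.asIdeal hne] at h
  intro hmem
  have h2 := FiniteMultiplicity.pow_dvd_iff_le_multiplicity
          (FiniteMultiplicity.of_prime_left q.prime hne) (k := 2)
  rw [h, Ideal.map_span, Set.image_singleton,
        Ideal.dvd_span_singleton] at h2
  have := h2.1 (by simpa using hmem)
  omega

end primes
end cyc
end Amb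


namespace Amb

set_option linter.unusedSectionVars false
section ram
open NumberField IsDedekindDomain Module

section unr
variable {K L : Type*} [Field K] [NumberField K] [Field L] [NumberField L] [Algebra K L]

lemma unram_aux (t : L) (m : ℤ) (ht : t ^ 2 = m) (hm : m % 4 = 1) (hgen : Algebra.adjoin K {t} = ⊤)
    (v : HeightOneSpectrum (𝓞 L)) (hv : (m : 𝓞 L) ∉ v.asIdeal) : eR K v = 1 := by
  obtain ⟨c, hc⟩ : ∃ c, m = 4 * c + 1 := ⟨m / 4, by omega⟩
  set P : Polynomial ℤ := Polynomial.X ^ 2 - Polynomial.X - Polynomial.C c with hP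
  have hPm : P.Monic := by rw [hP]; monicity!
  have hroot : ((1 + t) / 2) ^ 2 - ((1 + t) / 2) - (c : L) = 0 := by
    have : t ^ 2 = 4 * c + 1 := by rw [ht, hc]; push_cast; ring
    linear_combination (1 / 4) * this
  have hintegral : IsIntegral ℤ ((1 + t) / 2) := by
    refine ⟨P, hPm, ?_⟩
    rw [hP, Polynomial.eval₂_sub, Polynomial.eval₂_sub, Polynomial.eval₂_pow, Polynomial.eval₂_X,
      Polynomial.eval₂_C]
    simpa using hroot
  set θ : 𝓞 L := ⟨(1 + t) / 2, hintegral⟩ with hθ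
  have hθL : algebraMap (𝓞 L) L θ = (1 + t) / 2 := rfl
  have hθ2 : θ ^ 2 - θ - (c : 𝓞 L) = 0 := by
    apply RingOfIntegers.ext
    simpa [hθL] using hroot
  have hadj : Algebra.adjoin K {algebraMap (𝓞 L) L θ} = ⊤ := by
    rw [eq_top_iff, ← hgen, Algebra.adjoin_le_iff, Set.singleton_subset_iff, hθL]
    have h1 : (1 + t) / 2 ∈ Algebra.adjoin K {(1 + t) / 2} := Algebra.self_mem_adjoin_singleton _ _
    have h2 : t = (1 + t) / 2 + (1 + t) / 2 - 1 := by ring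
    have h3 := sub_mem (add_mem h1 h1) (one_mem (Algebra.adjoin K {(1 + t) / 2}))
    rw [← h2] at h3
    exact h3
  have hmem := aeval_derivative_mem_differentIdeal (𝓞 K) K L θ hadj
  set Q : Polynomial (𝓞 K) := Polynomial.X ^ 2 - Polynomial.X - Polynomial.C (c : 𝓞 K) with hQ
  have hQ0 : Polynomial.aeval θ Q = 0 := by
    rw [hQ]
    simpa using hθ2
  obtain ⟨R, hR⟩ := minpoly.isIntegrallyClosed_dvd (Algebra.IsIntegral.isIntegral (R := 𝓞 K) θ) hQ0
  have hder : Polynomial.aeval θ (Polynomial.derivative Q) ∈ differentIdeal (𝓞 K) (𝓞 L) := by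
    rw [hR, Polynomial.derivative_mul, map_add, map_mul, map_mul, minpoly.aeval, zero_mul, add_zero]
    exact Ideal.mul_mem_right _ _ hmem
  have hder2 : Polynomial.aeval θ (Polynomial.derivative Q) = 2 * θ - 1 := by
    rw [hQ]
    simp
    left
    norm_num
  rw [hder2] at hder
  have hsq : (2 * θ - 1) ^ 2 = (m : 𝓞 L) := by
    rw [hc]
    push_cast
    linear_combination 4 * hθ2
  have hnd : ¬ v.asIdeal ∣ differentIdeal (𝓞 K) (𝓞 L) := by
    intro h
    apply hv
    rw [← hsq]
    exact Ideal.pow_mem_of_mem _ (Ideal.le_of_dvd h hder) 2 (by norm_num)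
  have := not_dvd_differentIdeal_iff.1 hnd
  exact Ideal.ramificationIdx_eq_one v.asIdeal (𝓞 K)

lemma unram (s : L) (d : ℕ) (hs : s ^ 2 = d) (hodd : d % 2 = 1) (hgen : Algebra.adjoin K {s} = ⊤)
    (i : K) (hi : i ^ 2 = -1) (v : HeightOneSpectrum (𝓞 L)) (hv : (d : 𝓞 L) ∉ v.asIdeal) : eR K v = 1 := by
  have h4 : d % 4 = 1 ∨ d % 4 = 3 := by omega
  rcases h4 with h | h
  · exact unram_aux s d (by rw [hs]; simp) (by omega) hgen v (by simpa using hv)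
  · refine unram_aux (algebraMap K L i * s) (-d) ?_ (by omega) ?_ v ?_
    · rw [mul_pow, hs, ← map_pow, hi]
      simp
    · rw [eq_top_iff, ← hgen, Algebra.adjoin_le_iff, Set.singleton_subset_iff]
      have h1 := Algebra.self_mem_adjoin_singleton K (algebraMap K L i * s)
      have h2 := Subalgebra.smul_mem _ h1 (-i)
      have h3 : (-i) • (algebraMap K L i * s) = s := by
        rw [Algebra.smul_def, ← mul_assoc, ← map_mul, show -i * i = 1 by linear_combination -hi]
        simp
      rw [h3] at h2
      exact h2
    · simpa using hv

end unr

variable {K : Type*} [Field K] [NumberField K] [hK : IsCyclotomicExtension {8} ℚ K]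
variable (d : ℕ) (hd : Squarefree d) (hprimes : ∀ p ∈ d.primeFactors, p % 8 = 3)

include hd in
lemma exists_prime_mem {R : Type*} [CommRing R] (I : Ideal R) [I.IsPrime] (h : (d : R) ∈ I) :
    ∃ p ∈ d.primeFactors, (p : R) ∈ I := by
  rw [← Nat.prod_primeFactors_of_squarefree hd, Nat.cast_prod] at h
  obtain ⟨p, hp, h⟩ := (Ideal.IsPrime.prod_mem_iff).1 h
  exact ⟨p, hp, h⟩

lemma mem_of_prime {R : Type*} [CommRing R] (I : Ideal R) (p : ℕ) (hp : p ∈ d.primeFactors)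
    (h : (p : R) ∈ I) : (d : R) ∈ I := by
  obtain ⟨m, hm⟩ := Nat.dvd_of_mem_primeFactors hp
  rw [hm, Nat.cast_mul]
  exact Ideal.mul_mem_right _ _ h

include hK hd hprimes in
lemma d_not_mem_sq (q : HeightOneSpectrum (𝓞 K)) (h : (d : 𝓞 K) ∈ q.asIdeal) :
    (d : 𝓞 K) ∉ q.asIdeal ^ 2 := by
  obtain ⟨p, hp, hpq⟩ := exists_prime_mem d hd q.asIdeal h
  have hpp := Nat.prime_of_mem_primeFactors hp
  have : Fact p.Prime := ⟨hpp⟩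
  obtain ⟨m, hm⟩ := Nat.dvd_of_mem_primeFactors hp
  intro h2
  rw [hm, Nat.cast_mul, mul_comm] at h2
  rcases Ideal.IsPrime.mul_mem_pow _ h2 with h3 | h3
  · have hcop : Nat.Coprime p m := Nat.coprime_of_squarefree_mul (hm ▸ hd)
    have h4 : IsCoprime (p : 𝓞 K) (m : 𝓞 K) := hcop.cast
    obtain ⟨a, b, hab⟩ := h4
    apply q.isPrime.ne_top
    rw [Ideal.eq_top_iff_one, ← hab]
    exact add_mem (Ideal.mul_mem_left _ _ hpq) (Ideal.mul_mem_left _ _ h3)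
  · exact not_mem_sq p (hprimes p hp) q hpq h3

include hK hd hprimes in
lemma card_q : Finite {q : HeightOneSpectrum (𝓞 K) // (d : 𝓞 K) ∈ q.asIdeal} ∧
    Nat.card {q : HeightOneSpectrum (𝓞 K) // (d : 𝓞 K) ∈ q.asIdeal} = 2 * d.primeFactors.card := by
  let F : (Σ p : d.primeFactors, (Ideal.span {((p : ℕ) : ℤ)}).primesOver (𝓞 K)) →
      {q : HeightOneSpectrum (𝓞 K) // (d : 𝓞 K) ∈ q.asIdeal} := fun x =>
    have hmem : ((x.1 : ℕ) : 𝓞 K) ∈ x.2.1 := by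
      have h := x.2.2.2.over
      have h2 : ((x.1 : ℕ) : ℤ) ∈ Ideal.span {((x.1 : ℕ) : ℤ)} := Ideal.mem_span_singleton_self _
      rw [h] at h2
      simpa using h2
    ⟨⟨x.2.1, x.2.2.1, fun h => by
      rw [h] at hmem
      have := (Nat.prime_of_mem_primeFactors x.1.2).ne_zero
      simp at hmem
      exact this hmem⟩, mem_of_prime d _ _ x.1.2 hmem⟩
  have hF : Function.Bijective F := by
    constructor
    · rintro ⟨⟨p, hp⟩, ⟨P, hP, hPo⟩⟩ ⟨⟨p', hp'⟩, ⟨P', hP', hPo'⟩⟩ h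
      have h1 : P = P' := congrArg (fun z => z.1.asIdeal) h
      subst h1
      have h2 : p = p' := by
        have := hPo.over.trans hPo'.over.symm
        rw [Ideal.span_singleton_eq_span_singleton, Int.associated_iff_natAbs] at this
        simpa using this
      subst h2
      rfl
    · rintro ⟨q, hq⟩
      obtain ⟨p, hp, hpq⟩ := exists_prime_mem d hd q.asIdeal hq
      have : Fact p.Prime := ⟨Nat.prime_of_mem_primeFactors hp⟩
      exact ⟨⟨⟨p, hp⟩, ⟨q.asIdeal, q.isPrime, lies_over p q hpq⟩⟩, rfl⟩
  have hcard : ∀ p : d.primeFactors, Nat.card ((Ideal.span {((p : ℕ) : ℤ)}).primesOver (𝓞 K)) = 2 := by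
    intro p
    have : Fact (p : ℕ).Prime := ⟨Nat.prime_of_mem_primeFactors p.2⟩
    exact ncard_primesOver K (p : ℕ) (hprimes p p.2)
  have hfin : ∀ p : d.primeFactors, Finite ((Ideal.span {((p : ℕ) : ℤ)}).primesOver (𝓞 K)) := by
    intro p
    apply Nat.finite_of_card_ne_zero
    rw [hcard]
    norm_num
  refine ⟨Finite.of_surjective F hF.2, ?_⟩
  rw [← Nat.card_congr (Equiv.ofBijective F hF), Nat.card_sigma]
  simp [hcard, mul_comm]

section count
variable {L : Type*} [Field L] [NumberField L] [Algebra K L]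
  (σ : Gal(L/K)) (hσ : ∀ g : Gal(L/K), g = 1 ∨ g = σ) (hσ2 : ∀ x, σ (σ x) = x) [IsGalois K L]
  (hcard : Nat.card Gal(L/K) = 2) (s : L) (hs : s ^ 2 = d) (hgen : Algebra.adjoin K {s} = ⊤)
  (i : K) (hi : i ^ 2 = -1)

lemma mem_pP (v : HeightOneSpectrum (𝓞 L)) (n : ℕ) :
    (n : 𝓞 K) ∈ (pP (K := K) v).asIdeal ↔ (n : 𝓞 L) ∈ v.asIdeal := by
  rw [pP_asIdeal, Ideal.mem_comap, map_natCast]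

include hK hd hprimes hσ hσ2 hcard hs hgen hi in
lemma eR_iff (v : HeightOneSpectrum (𝓞 L)) : eR K v = 2 ↔ (d : 𝓞 L) ∈ v.asIdeal := by
  have hpid := K_pid K
  constructor
  · intro h
    by_contra hv
    have hodd : d % 2 = 1 := by
      by_contra h2
      have : 2 ∈ d.primeFactors := by
        rw [Nat.mem_primeFactors]
        exact ⟨Nat.prime_two, by omega, hd.ne_zero⟩
      have := hprimes 2 this
      omega
    have := unram s d hs hodd hgen i hi v hv
    omega
  · intro h
    have hq := (mem_pP (K := K) v d).2 h
    have hq2 := d_not_mem_sq d hd hprimes _ hq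
    have hdK : (d : K) ≠ 0 := by exact_mod_cast hd.ne_zero
    have hs0 : s ≠ 0 := by
      rintro rfl
      have : (d : L) = 0 := by rw [← hs]; simp
      have : d = 0 := by exact_mod_cast this
      exact hd.ne_zero this
    have hmap : algebraMap (𝓞 K) K (d : 𝓞 K) = (Units.mk0 (d : K) hdK : Kˣ) := by simp
    have h1 : (dv (𝓞 K) K (Units.mk0 (d : K) hdK)).toAdd (pP v) = 1 := by
      have e1 := (dv_mem_pow K (Units.mk0 (d : K) hdK) (d : 𝓞 K) hmap (pP v) 1).1 (by simpa using hq)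
      have e2 := (dv_mem_pow K (Units.mk0 (d : K) hdK) (d : 𝓞 K) hmap (pP v) 2).not.1 hq2
      push_cast at e1 e2
      omega
    have h2 := dv_iU (L := L) (Units.mk0 (d : K) hdK) v
    have h3 : iU (L := L) (Units.mk0 (d : K) hdK) = (Units.mk0 s hs0) ^ 2 := by
      apply Units.ext
      simp [hs]
    rw [h1, h3, map_pow, toAdd_pow, Finsupp.smul_apply] at h2
    rcases eR_cases σ hσ hσ2 hcard v with h4 | h4
    · rw [h4] at h2
      simp at h2
      omega
    · exact h4.1

include hK hd hprimes hσ hσ2 hcard hs hgen hi in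
lemma card_T : Finite {v : HeightOneSpectrum (𝓞 L) // eR K v = 2} ∧
    Nat.card {v : HeightOneSpectrum (𝓞 L) // eR K v = 2} = 2 * d.primeFactors.card := by
  obtain ⟨f1, f2⟩ := card_q (K := K) d hd hprimes
  have key := eR_iff d hd hprimes σ hσ hσ2 hcard s hs hgen i hi
  let F : {v : HeightOneSpectrum (𝓞 L) // eR K v = 2} →
    {q : HeightOneSpectrum (𝓞 K) // (d : 𝓞 K) ∈ q.asIdeal} := fun v =>
      ⟨pP v.1, (mem_pP v.1 d).2 ((key v.1).1 v.2)⟩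
  have hF : Function.Bijective F := by
    constructor
    · rintro ⟨v, hv⟩ ⟨v', hv'⟩ h
      have h1 : pP (K := K) v = pP v' := congrArg Subtype.val h
      rcases (pP_eq_iff σ hσ hσ2 v v').1 h1 with h2 | h2
      · exact Subtype.ext h2.symm
      · rcases eR_cases σ hσ hσ2 hcard v with h3 | h3
        · omega
        · exact Subtype.ext (h2.trans h3.2).symm
    · rintro ⟨q, hq⟩
      obtain ⟨v, rfl⟩ := pP_surjective (K := K) (L := L) q
      exact ⟨⟨v, (key v).2 ((mem_pP v d).1 hq)⟩, rfl⟩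
  rw [Nat.card_congr (Equiv.ofBijective F hF)]
  exact ⟨Finite.of_injective F hF.1, f2⟩

end count
end ram
end Amb


namespace Amb

set_option linter.unusedSectionVars false
section quad
open NumberField IsDedekindDomain Module

variable {K : Type*} [Field K] [NumberField K] [hK : IsCyclotomicExtension {8} ℚ K]
variable (d : ℕ) (hd1 : 1 < d) (hd : Squarefree d) (hprimes : ∀ p ∈ d.primeFactors, p % 8 = 3)

include hK in
lemma exists_prime_over (p : ℕ) (hp : p.Prime) (hp8 : p % 8 = 3) :
    ∃ q : HeightOneSpectrum (𝓞 K), (p : 𝓞 K) ∈ q.asIdeal := by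
  have hf : Fact p.Prime := ⟨hp⟩
  obtain ⟨_, h⟩ := card_q (K := K) p hp.prime.squarefree (by
    intro p' hp'
    rw [Nat.Prime.primeFactors hp, Finset.mem_singleton] at hp'
    rw [hp', hp8])
  rw [Nat.Prime.primeFactors hp, Finset.card_singleton] at h
  have : Nonempty {q : HeightOneSpectrum (𝓞 K) // (p : 𝓞 K) ∈ q.asIdeal} := by
    by_contra hne
    rw [not_nonempty_iff] at hne
    rw [Nat.card_of_isEmpty] at h
    omega
  obtain ⟨⟨q, hq⟩⟩ := this
  exact ⟨q, hq⟩

include hd1 hd hprimes hK in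
lemma exists_q_d : ∃ q : HeightOneSpectrum (𝓞 K), ∃ p ∈ d.primeFactors, (p : 𝓞 K) ∈ q.asIdeal ∧
    (d : 𝓞 K) ∈ q.asIdeal ∧ (d : 𝓞 K) ∉ q.asIdeal ^ 2 := by
  obtain ⟨p, hp⟩ := Nat.nonempty_primeFactors.2 hd1
  obtain ⟨q, hq⟩ := exists_prime_over (K := K) p (Nat.prime_of_mem_primeFactors hp) (hprimes p hp)
  have h1 := mem_of_prime d q.asIdeal p hp hq
  exact ⟨q, p, hp, hq, h1, d_not_mem_sq d hd hprimes q h1⟩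

include hd1 hd hprimes hK in
lemma d_not_sq (b : K) : b ^ 2 ≠ (d : K) := by
  intro hb
  obtain ⟨q, p, hp, hpq, h1, h2⟩ := exists_q_d (K := K) d hd1 hd hprimes
  have hdK : (d : K) ≠ 0 := by exact_mod_cast hd.ne_zero
  have hb0 : b ≠ 0 := by
    rintro rfl
    apply hdK
    rw [← hb]
    simp
  have hmap : algebraMap (𝓞 K) K (d : 𝓞 K) = ((Units.mk0 b hb0) ^ 2 : Kˣ) := by simp [hb]
  have e1 := (dv_mem_pow K _ (d : 𝓞 K) hmap q 1).1 (by simpa using h1)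
  have e2 := (dv_mem_pow K _ (d : 𝓞 K) hmap q 2).not.1 h2
  rw [map_pow, toAdd_pow, Finsupp.smul_apply] at e1 e2
  simp only [smul_eq_mul, nsmul_eq_mul] at e1 e2
  push_cast at e1 e2
  omega

variable {L : Type*} [Field L] [NumberField L] [Algebra K L] (s : L) (hs : s ^ 2 = d)
  (hgen : Algebra.adjoin K {s} = ⊤)

include hgen hs hK hd1 hd hprimes in
lemma L_quad : finrank K L = 2 := by
  have hirr : Irreducible (Polynomial.X ^ 2 - Polynomial.C (d : K)) :=
    (X_pow_sub_C_irreducible_iff_of_prime Nat.prime_two).2 (d_not_sq d hd1 hd hprimes)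
  have hintegral : IsIntegral K s := Algebra.IsIntegral.isIntegral s
  have hmin : Polynomial.X ^ 2 - Polynomial.C (d : K) = minpoly K s :=
    minpoly.eq_of_irreducible_of_monic hirr (by simp [hs]) (by monicity!)
  have htop : IntermediateField.adjoin K {s} = ⊤ := by
    rw [← IntermediateField.toSubalgebra_inj, IntermediateField.adjoin_simple_toSubalgebra_of_isAlgebraic hintegral.isAlgebraic, hgen]
    rfl
  have h := IntermediateField.adjoin.finrank hintegral
  rw [htop, IntermediateField.finrank_top', ← hmin] at h
  rw [h]
  compute_degree!

include hgen hs hK hd1 hd hprimes in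
theorem setup : ∃ σ : Gal(L/K), σ s = -s ∧ (∀ g : Gal(L/K), g = 1 ∨ g = σ) ∧ (∀ x, σ (σ x) = x) ∧
    IsGalois K L ∧ Nat.card Gal(L/K) = 2 ∧ finrank ℚ L = 8 := by
  have hf := L_quad d hd1 hd hprimes s hs hgen
  have hq : Algebra.IsQuadraticExtension K L := ⟨hf⟩
  have hgal : IsGalois K L := inferInstance
  have hcard : Nat.card Gal(L/K) = 2 := by rw [IsGalois.card_aut_eq_finrank, hf]
  have hpm : ∀ g : Gal(L/K), g s = s ∨ g s = -s := by
    intro g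
    rw [← sq_eq_sq_iff_eq_or_eq_neg, ← map_pow, hs, map_natCast]
  have hext : ∀ g g' : Gal(L/K), g s = g' s → g = g' := by
    intro g g' h
    have : (g : L →ₐ[K] L) = g' := AlgHom.ext_of_adjoin_eq_top hgen (by
      intro x hx
      rw [Set.mem_singleton_iff.1 hx]
      exact h)
    ext x
    exact DFunLike.congr_fun this x
  obtain ⟨σ, hσ⟩ : ∃ σ : Gal(L/K), σ ≠ 1 := by
    by_contra! h
    have : Subsingleton Gal(L/K) := ⟨fun a b => by rw [h a, h b]⟩
    rw [Nat.card_unique] at hcard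
    omega
  have hσs : σ s = -s := by
    rcases hpm σ with h | h
    · exact absurd (hext σ 1 h) hσ
    · exact h
  refine ⟨σ, hσs, ?_, ?_, hgal, hcard, ?_⟩
  · intro g
    rcases hpm g with h | h
    · exact Or.inl (hext g 1 h)
    · exact Or.inr (hext g σ (h.trans hσs.symm))
  · intro x
    have : σ * σ = 1 := hext _ _ (by
      change σ (σ s) = s
      rw [hσs, map_neg, hσs, neg_neg])
    exact DFunLike.congr_fun this x
  · rw [← finrank_mul_finrank ℚ K L, hf, K_finrank]

include hgen hs hK hd1 hd hprimes in
theorem class_formula (i : K) (hi : i ^ 2 = -1) : ∃ N : Subgroup (𝓞 K)ˣ,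
    (∀ u, u ∈ N ↔ ∃ a b : K, a ^ 2 - d * b ^ 2 = (u : 𝓞 K)) ∧
    Nat.card {c : ClassGroup (𝓞 L) // c ^ 2 = 1} * (2 * N.index) = 2 ^ (2 * d.primeFactors.card) ∧
    (powMonoidHom 2 : (𝓞 K)ˣ →* (𝓞 K)ˣ).range.index = 4 := by
  obtain ⟨σ, hσs, hσ, hσ2, hgal, hcard, hL⟩ := setup d hd1 hd hprimes s hs hgen
  have hpid := K_pid K
  have := K_complex K
  have : IsTotallyComplex L := isTotallyComplex_of_algebra K L
  have hrL : Units.rank L = 3 := by rw [rank_complex, hL]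
  have hs0 : s ≠ 0 := by
    rintro rfl
    have : (d : L) = 0 := by rw [← hs]; simp
    have : d = 0 := by exact_mod_cast this
    exact hd.ne_zero this
  obtain ⟨hT, hT2⟩ := card_T d hd hprimes σ hσ hσ2 hcard s hs hgen i hi
  obtain ⟨h1, h2⟩ := main_formula σ hσ hσ2 hcard s hs0 hσs (K_rank K) hrL hT
  refine ⟨normUnits σ, ?_, ?_, h2⟩
  · intro u
    rw [mem_normUnits]
    constructor
    · rintro ⟨x, hx⟩
      obtain ⟨a, ha⟩ := (fixed_iff σ hσ ((x + σ x) / 2)).1 (by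
        rw [map_div₀, map_add, hσ2, map_ofNat, add_comm])
      obtain ⟨b, hb⟩ := (fixed_iff σ hσ ((x - σ x) / (2 * s))).1 (by
        rw [map_div₀, map_sub, hσ2, map_mul, map_ofNat, hσs, mul_neg, div_neg, ← neg_div, neg_sub])
      refine ⟨a, b, (algebraMap K L).injective ?_⟩
      rw [← hx, map_sub, map_mul, map_pow, map_pow, ha, hb, map_natCast, ← hs]
      field_simp
      ring
    · rintro ⟨a, b, hab⟩
      refine ⟨algebraMap K L a + algebraMap K L b * s, ?_⟩
      rw [← hab, map_add, map_mul, hσs, σ.commutes, σ.commutes, map_sub, map_mul, map_pow, map_pow,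
        map_natCast, ← hs]
      ring
  · rw [h1, hT2]

include hK hd1 hd hprimes in
theorem class_formula' (i : K) (hi : i ^ 2 = -1) : ∃ N : Subgroup (𝓞 K)ˣ,
    (∀ u, u ∈ N ↔ ∃ a b : K, a ^ 2 - d * b ^ 2 = (u : 𝓞 K)) ∧
    2 * N.index ∣ 2 ^ (2 * d.primeFactors.card) ∧
    (powMonoidHom 2 : (𝓞 K)ˣ →* (𝓞 K)ˣ).range.index = 4 := by
  have hirr : Irreducible (Polynomial.X ^ 2 - Polynomial.C (d : K)) :=
    (X_pow_sub_C_irreducible_iff_of_prime Nat.prime_two).2 (d_not_sq d hd1 hd hprimes)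
  set f := Polynomial.X ^ 2 - Polynomial.C (d : K) with hf
  have hfm : f.Monic := by rw [hf]; monicity!
  have hfact : Fact (Irreducible f) := ⟨hirr⟩
  have hfin : Module.Finite K (AdjoinRoot f) := hfm.finite_adjoinRoot
  have hnf : NumberField (AdjoinRoot f) := NumberField.of_module_finite K (AdjoinRoot f)
  obtain ⟨N, h1, h2, h3⟩ := class_formula (L := AdjoinRoot f) d hd1 hd hprimes (AdjoinRoot.root f) (by
    have := AdjoinRoot.eval₂_root f
    rw [hf, Polynomial.eval₂_sub, Polynomial.eval₂_pow, Polynomial.eval₂_X,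
      Polynomial.eval₂_C, sub_eq_zero] at this
    rw [this]
    simp) AdjoinRoot.adjoinRoot_eq_top i hi
  exact ⟨N, h1, Dvd.intro_left _ h2, h3⟩

end quad
end Amb


namespace Amb

set_option linter.unusedSectionVars false

section ff
variable {F : Type*} [Field F] [Finite F] (p : ℕ) (hp : p.Prime) (hp8 : p % 8 = 3)
  (hF : Nat.card F = p ^ 2) (hpF : (p : F) = 0) (z : F) (hz : z ^ 4 = -1)

include hp8 hpF in
omit [Finite F] in
lemma two_ne : (2 : F) ≠ 0 := by
  intro h
  obtain ⟨k, hk⟩ : ∃ k, p = 2 * k + 1 := ⟨p / 2, by omega⟩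
  rw [hk] at hpF
  push_cast at hpF
  rw [h] at hpF
  simp at hpF

lemma pow_card (c : F) (hc : c ≠ 0) : c ^ (Nat.card F - 1) = 1 := by
  have := Fintype.ofFinite F
  rw [Nat.card_eq_fintype_card]
  exact FiniteField.pow_card_sub_one_eq_one c hc

include hp8 hF hpF hz in
lemma nonsq1 (c : F) (hc : c ^ 2 = z) : False := by
  have h2 := two_ne (F := F) p hp8 hpF
  have hc8 : c ^ 8 = -1 := by rw [← hz, ← hc]; ring
  have hc0 : c ≠ 0 := by
    rintro rfl
    simp at hc8
  obtain ⟨k, hk⟩ : ∃ k, p = 8 * k + 3 := ⟨p / 8, by omega⟩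
  have h := pow_card c hc0
  have h3 : p ^ 2 - 1 = 8 * (2 * (4 * k ^ 2 + 3 * k) + 1) := by
    rw [hk]
    have : (8 * k + 3) ^ 2 = 8 * (2 * (4 * k ^ 2 + 3 * k) + 1) + 1 := by ring
    omega
  rw [hF, h3, pow_mul, hc8, pow_succ, pow_mul] at h
  simp at h
  apply h2
  linear_combination -h

include hp hp8 hF hpF hz in
lemma nonsq2 (c : F) (hc : c ^ 2 = z * (z - z ^ 2 - 1)) : False := by
  have h2 := two_ne (F := F) p hp8 hpF
  have hfp : Fact p.Prime := ⟨hp⟩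
  have hch : CharP F p := (CharP.charP_iff_prime_eq_zero hp).2 hpF
  have hi : (1 + z ^ 2) * (1 - z ^ 2) = 2 := by linear_combination -hz
  have h10 : 1 + z ^ 2 ≠ 0 := by
    intro h
    rw [h, zero_mul] at hi
    exact h2 hi.symm
  have h11 : 1 - z ≠ 0 := by
    intro h
    have : 1 - z ^ 2 = 0 := by linear_combination (1 + z) * h
    rw [this, mul_zero] at hi
    exact h2 hi.symm
  obtain ⟨e, he⟩ : ∃ e : F, e ^ 2 = 1 + z ^ 2 := by
    refine ⟨z ^ 3 * (1 + z ^ 2) * c / (1 - z), ?_⟩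
    rw [div_pow, div_eq_iff (pow_ne_zero 2 h11), mul_pow, hc]
    linear_combination (-1 + 2*z - 2*z^2 + 2*z^3 - 2*z^5 + 2*z^6 - 3*z^7 + z^8 - z^9) * hz
  have he0 : e ≠ 0 := by
    rintro rfl
    apply h10
    rw [← he]
    simp
  obtain ⟨k, hk⟩ : ∃ k, p = 8 * k + 3 := ⟨p / 8, by omega⟩
  have hfrob : (1 + z ^ 2) ^ p = 1 - z ^ 2 := by
    rw [add_pow_char, one_pow, ← pow_mul, hk, show 2 * (8 * k + 3) = 4 * (4 * k + 1) + 2 by ring,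
      pow_add, pow_mul, hz, pow_succ, pow_mul]
    norm_num
    ring
  have h3 : (1 + z ^ 2) ^ (p + 1) = 2 := by
    rw [pow_succ, hfrob, ← hi]
    ring
  have h4 : (2 : F) ^ (p / 2) = -1 := by
    have hz2 : (2 : ZMod p) ≠ 0 := by
      intro h
      have h5 : ((2 : ℕ) : ZMod p) = 0 := by exact_mod_cast h
      rw [ZMod.natCast_eq_zero_iff] at h5
      have := Nat.le_of_dvd (by norm_num) h5
      omega
    have h5 : ¬ IsSquare (2 : ZMod p) := by
      rw [ZMod.exists_sq_eq_two_iff (by omega)]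
      omega
    rw [ZMod.euler_criterion p hz2] at h5
    have h6 := (ZMod.pow_div_two_eq_neg_one_or_one p hz2).resolve_left h5
    have h7 := congrArg (ZMod.castHom (dvd_refl p) F) h6
    rw [map_pow, map_neg, map_one, map_ofNat] at h7
    exact h7
  have h := pow_card e he0
  have h5 : p ^ 2 - 1 = 2 * ((p + 1) * (p / 2)) := by
    rw [hk, show (8 * k + 3) / 2 = 4 * k + 1 by omega]
    have : (8 * k + 3) ^ 2 = 2 * ((8 * k + 3 + 1) * (4 * k + 1)) + 1 := by ring
    omega
  rw [hF, h5, pow_mul, he, pow_mul, h3, h4] at h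
  apply h2
  linear_combination -h

omit hpF in
lemma nonsq17 (hF17 : Nat.card F = 17) (h17 : (17 : F) = 0) (hz : z ^ 4 = -1) (c : F) (hc : c ^ 2 = z - z ^ 2 - 1) :
    False := by
  have h2 : (2 : F) ≠ 0 := by
    intro h
    have : (1 : F) = 0 := by linear_combination h17 - 8 * h
    exact one_ne_zero this
  have hu2 : (z - z ^ 2 - 1) ^ 2 = 3 * z ^ 2 - 2 * z ^ 3 - 2 * z := by
    linear_combination hz
  have hu4 : (z - z ^ 2 - 1) ^ 4 = 12 * (z - z ^ 3) := by
    rw [show (z - z ^ 2 - 1) ^ 4 = ((z - z ^ 2 - 1) ^ 2) ^ 2 by ring, hu2]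
    linear_combination (17 - 12 * z + 4 * z ^ 2) * hz - h17
  have hu8 : (z - z ^ 2 - 1) ^ 8 = -1 := by
    rw [show (z - z ^ 2 - 1) ^ 8 = ((z - z ^ 2 - 1) ^ 4) ^ 2 by ring, hu4]
    linear_combination (144 * z ^ 2 - 288) * hz + 17 * h17
  have hc16 : c ^ 16 = -1 := by
    rw [← hu8, ← hc]
    ring
  have hc0 : c ≠ 0 := by
    rintro rfl
    simp at hc16
  have h := pow_card c hc0
  rw [hF17] at h
  norm_num at h
  rw [h] at hc16
  apply h2
  linear_combination hc16

end ff
end Amb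


namespace Amb

set_option linter.unusedSectionVars false
section loc
open NumberField IsDedekindDomain Module

/-- Descent: a nontrivial solution of `A² - dB² = wC²` makes `w` a square modulo `q`, if
`q` divides `d` exactly once. -/
lemma local_aux {R : Type*} [CommRing R] [IsDedekindDomain R] [IsPrincipalIdealRing R]
    (q : HeightOneSpectrum R) (d w : R) (hdq : d ∈ q.asIdeal) (hdq2 : d ∉ q.asIdeal ^ 2) (n : ℕ) :
    ∀ A B C : R, A ^ 2 - d * B ^ 2 = w * C ^ 2 → C ∉ q.asIdeal ^ n → ∃ c : R, c ^ 2 - w ∈ q.asIdeal := by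
  have hprime := q.isPrime
  have hmax := q.isMaximal
  induction n with
  | zero => intro A B C _ h; simp at h
  | succ n ih =>
    intro A B C h hC
    by_cases hCq : C ∈ q.asIdeal
    · have hA2 : A ^ 2 ∈ q.asIdeal := by
        have : A ^ 2 = d * B ^ 2 + w * C ^ 2 := by linear_combination h
        rw [this]
        exact add_mem (Ideal.mul_mem_right _ _ hdq)
          (Ideal.mul_mem_left _ _ (Ideal.pow_mem_of_mem _ hCq 2 (by norm_num)))
      have hA := hprime.mem_of_pow_mem 2 hA2
      have hdB : d * B ^ 2 ∈ q.asIdeal ^ 2 := by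
        have : d * B ^ 2 = A ^ 2 - w * C ^ 2 := by linear_combination -h
        rw [this]
        exact sub_mem (Ideal.pow_mem_pow hA 2) (Ideal.mul_mem_left _ _ (Ideal.pow_mem_pow hCq 2))
      have hB : B ∈ q.asIdeal := by
        by_contra hB
        rw [mul_comm] at hdB
        rcases Ideal.IsPrime.mul_mem_pow q.asIdeal hdB with h1 | h1
        · exact hB (hprime.mem_of_pow_mem 2 h1)
        · exact hdq2 h1
      obtain ⟨π, hπ⟩ := (IsPrincipalIdealRing.principal q.asIdeal).principal
      have hπ0 : π ≠ 0 := by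
        rintro rfl
        apply q.ne_bot
        rw [hπ]
        simp
      have key : ∀ x ∈ q.asIdeal, ∃ y, x = π * y := by
        intro x hx
        rw [hπ] at hx
        obtain ⟨y, hy⟩ := Ideal.mem_span_singleton.1 hx
        exact ⟨y, hy⟩
      have hπq : π ∈ q.asIdeal := by rw [hπ]; exact Ideal.mem_span_singleton_self π
      obtain ⟨A', rfl⟩ := key A hA
      obtain ⟨B', rfl⟩ := key B hB
      obtain ⟨C', rfl⟩ := key C hCq
      refine ih A' B' C' ?_ ?_
      · apply mul_left_cancel₀ (pow_ne_zero 2 hπ0)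
        linear_combination h
      · intro hC'
        apply hC
        rw [pow_succ']
        exact Ideal.mul_mem_mul hπq hC'
    · obtain ⟨y, hy⟩ := hmax.exists_inv hCq
      obtain ⟨i, hi, hyi⟩ := hy
      have hi' : y * C - 1 ∈ q.asIdeal := by
        have : y * C - 1 = -i := by linear_combination hyi
        rw [this]
        exact neg_mem hi
      refine ⟨A * y, ?_⟩
      have : (A * y) ^ 2 - w = d * (B * y) ^ 2 + (w * (y * C + 1)) * (y * C - 1) := by
        linear_combination y ^ 2 * h
      rw [this]
      exact add_mem (Ideal.mul_mem_right _ _ hdq) (Ideal.mul_mem_left _ _ hi')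

lemma exists_not_mem_pow {R : Type*} [CommRing R] [IsDedekindDomain R] (q : HeightOneSpectrum R)
    (C : R) (hC : C ≠ 0) : ∃ n, C ∉ q.asIdeal ^ n := by
  by_contra! h
  have h1 := Ideal.iInf_pow_eq_bot_of_isDomain q.asIdeal q.isPrime.ne_top
  have : C ∈ (⨅ i : ℕ, q.asIdeal ^ i) := by
    rw [Ideal.mem_iInf]
    exact h
  rw [h1] at this
  exact hC this

lemma local_norm {K : Type*} [Field K] [NumberField K] [IsPrincipalIdealRing (𝓞 K)]
    (q : HeightOneSpectrum (𝓞 K)) (d : ℕ) (w : 𝓞 K) (hdq : (d : 𝓞 K) ∈ q.asIdeal)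
    (hdq2 : (d : 𝓞 K) ∉ q.asIdeal ^ 2) (a b : K) (h : a ^ 2 - d * b ^ 2 = (w : K)) :
    ∃ c : 𝓞 K, c ^ 2 - w ∈ q.asIdeal := by
  obtain ⟨A, B, C, hC, hA, hB⟩ : ∃ A B C : 𝓞 K, C ≠ 0 ∧
      a * algebraMap (𝓞 K) K C = algebraMap (𝓞 K) K A ∧
      b * algebraMap (𝓞 K) K C = algebraMap (𝓞 K) K B := by
    obtain ⟨A, C, hC, rfl⟩ := IsFractionRing.div_surjective (𝓞 K) a
    obtain ⟨B, D, hD, rfl⟩ := IsFractionRing.div_surjective (𝓞 K) b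
    have hC0 := nonZeroDivisors.ne_zero hC
    have hD0 := nonZeroDivisors.ne_zero hD
    have hC1 : algebraMap (𝓞 K) K C ≠ 0 := by simpa using hC0
    have hD1 : algebraMap (𝓞 K) K D ≠ 0 := by simpa using hD0
    refine ⟨A * D, B * C, C * D, mul_ne_zero hC0 hD0, ?_, ?_⟩
    · rw [map_mul, map_mul]
      field_simp
    · rw [map_mul, map_mul]
      field_simp
  obtain ⟨n, hn⟩ := exists_not_mem_pow q C hC
  change _ = algebraMap (𝓞 K) K w at h
  refine local_aux q d w hdq hdq2 n A B C ?_ hn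
  apply FaithfulSMul.algebraMap_injective (𝓞 K) K
  rw [map_sub, map_mul, map_mul, map_pow, map_pow, map_pow, map_natCast, ← hA, ← hB, ← h]
  ring

end loc

section fin
open NumberField IsDedekindDomain Module

variable {K : Type*} [Field K] [NumberField K] [hK : IsCyclotomicExtension {8} ℚ K]
variable (z u : (𝓞 K)ˣ) (hz : (z : 𝓞 K) ^ 4 = -1) (hu : (u : 𝓞 K) = z - z ^ 2 - 1)

include hK hz hu in
lemma not_norm (d : ℕ) (hd1 : 1 < d) (hd : Squarefree d) (hprimes : ∀ p ∈ d.primeFactors, p % 8 = 3)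
    (N : Subgroup (𝓞 K)ˣ) (hN : ∀ u, u ∈ N ↔ ∃ a b : K, a ^ 2 - d * b ^ 2 = (u : 𝓞 K)) :
    z ∉ N ∧ z * u ∉ N := by
  have hpid := K_pid K
  obtain ⟨q, p, hp, hpq, hdq, hdq2⟩ := exists_q_d (K := K) d hd1 hd hprimes
  have hfp : Fact p.Prime := ⟨Nat.prime_of_mem_primeFactors hp⟩
  have hcard := card_residue p (hprimes p hp) q hpq
  have hmax := q.isMaximal
  let _ := Ideal.Quotient.field q.asIdeal
  have hfin : Finite (𝓞 K ⧸ q.asIdeal) := Nat.finite_of_card_ne_zero (by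
    rw [hcard]; exact pow_ne_zero 2 hfp.out.ne_zero)
  have hp0 : ((p : ℕ) : 𝓞 K ⧸ q.asIdeal) = 0 := by
    have := Ideal.Quotient.eq_zero_iff_mem.2 hpq
    rwa [map_natCast] at this
  have hz' : (Ideal.Quotient.mk q.asIdeal z) ^ 4 = -1 := by
    rw [← map_pow, hz, map_neg, map_one]
  constructor
  · intro h
    obtain ⟨a, b, hab⟩ := (hN z).1 h
    obtain ⟨c, hc⟩ := local_norm q d z hdq hdq2 a b hab
    refine nonsq1 p (hprimes p hp) hcard hp0 _ hz' (Ideal.Quotient.mk q.asIdeal c) ?_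
    rw [← map_pow]
    exact Ideal.Quotient.eq.2 hc
  · intro h
    obtain ⟨a, b, hab⟩ := (hN (z * u)).1 h
    obtain ⟨c, hc⟩ := local_norm q d _ hdq hdq2 a b hab
    refine nonsq2 p hfp.out (hprimes p hp) hcard hp0 _ hz' (Ideal.Quotient.mk q.asIdeal c) ?_
    have := Ideal.Quotient.eq.2 hc
    rw [map_pow] at this
    rw [this, Units.val_mul, hu]
    simp

include hK hz hu in
lemma u_not_sq (x : 𝓞 K) : x ^ 2 ≠ u := by
  intro hx
  have hfp : Fact (Nat.Prime 17) := ⟨by norm_num⟩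
  have hmax17 : (Ideal.span {((17 : ℕ) : ℤ)}).IsMaximal := Int.ideal_span_isMaximal_of_prime 17
  have : (Ideal.span {((17 : ℕ) : ℤ)}).IsPrime := hmax17.isPrime
  obtain ⟨Q, hQ1, hQ2⟩ := Ideal.nonempty_primesOver (S := 𝓞 K) (P := Ideal.span {((17 : ℕ) : ℤ)})
  have h17 : (17 : 𝓞 K) ∈ Q := by
    have h1 : ((17 : ℕ) : ℤ) ∈ Ideal.span {((17 : ℕ) : ℤ)} := Ideal.mem_span_singleton_self _
    rw [hQ2.over, Ideal.mem_comap] at h1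
    simpa using h1
  have hmax : Q.IsMaximal := Ideal.IsMaximal.of_liesOver_isMaximal Q (Ideal.span {((17 : ℕ) : ℤ)})
  have h := IsCyclotomicExtension.Rat.inertiaDeg_eq_of_not_dvd (m := 8) 17 K Q (by norm_num)
  have ho : orderOf ((17 : ℕ) : ZMod 8) = 1 := by
    rw [orderOf_eq_one_iff]
    decide
  rw [ho] at h
  have h2 : 17 ^ Q.inertiaDeg ℤ = Ideal.absNorm Q := Ideal.pow_inertiaDeg 17 Q
  rw [h] at h2
  have hcard : Nat.card (𝓞 K ⧸ Q) = 17 := h2.symm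
  let _ := Ideal.Quotient.field Q
  have hfin : Finite (𝓞 K ⧸ Q) := Nat.finite_of_card_ne_zero (by rw [hcard]; norm_num)
  have hz' : (Ideal.Quotient.mk Q z) ^ 4 = -1 := by
    rw [← map_pow, hz, map_neg, map_one]
  refine nonsq17 (Ideal.Quotient.mk Q z) hcard ?_ hz' (Ideal.Quotient.mk Q x) ?_
  · have := Ideal.Quotient.eq_zero_iff_mem.2 h17
    rwa [map_ofNat] at this
  · rw [← map_pow, hx, hu]
    simp

include hz in
lemma zz_mem (d : ℕ) 
    (N : Subgroup (𝓞 K)ˣ) (hN : ∀ u, u ∈ N ↔ ∃ a b : K, a ^ 2 - d * b ^ 2 = (u : 𝓞 K)) (v : (𝓞 K)ˣ) :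
    v ^ 2 ∈ N := by
  rw [hN]
  exact ⟨v, 0, by simp⟩

include hK hz hu in
lemma u_norm_prime (p : ℕ) (hp : p.Prime) (hp8 : p % 8 = 3) :
    ∃ a b : K, a ^ 2 - p * b ^ 2 = (u : 𝓞 K) := by
  have hpr : ∀ p' ∈ p.primeFactors, p' % 8 = 3 := by
    intro p' hp'
    rw [Nat.Prime.primeFactors hp, Finset.mem_singleton] at hp'
    rw [hp', hp8]
  obtain ⟨N, hN, hdvd, -⟩ := class_formula' (K := K) p hp.one_lt hp.prime.squarefree hpr
    (((z : 𝓞 K) : K) ^ 2) (by rw [← pow_mul]; exact_mod_cast congrArg (algebraMap (𝓞 K) K) hz)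
  obtain ⟨h1, h2⟩ := not_norm z u hz hu p hp.one_lt hp.prime.squarefree hpr N hN
  rw [Nat.Prime.primeFactors hp, Finset.card_singleton] at hdvd
  have h3 : N.index ∣ 2 := Nat.dvd_of_mul_dvd_mul_left two_pos (by simpa using hdvd)
  have h4 : N.index = 2 := by
    rcases (Nat.dvd_prime Nat.prime_two).1 h3 with h | h
    · rw [Subgroup.index_eq_one] at h
      exact absurd (h ▸ Subgroup.mem_top z) h1
    · exact h
  have h5 : z * (z * u) ∈ N := (Subgroup.mul_mem_iff_of_index_two h4).2 (by simp [h1, h2])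
  rw [← mul_assoc, ← sq] at h5
  exact (hN u).1 ((Subgroup.mul_mem_cancel_left N (zz_mem z hz p N hN z)).1 h5)

include hK hz hu in
lemma u_norm (d : ℕ) (hd1 : 1 < d) (hd : Squarefree d) (hprimes : ∀ p ∈ d.primeFactors, p % 8 = 3) :
    ∃ a b : K, a ^ 2 - d * b ^ 2 = (u : 𝓞 K) := by
  have huns : ∀ x : K, x ^ 2 ≠ (u : 𝓞 K) := by
    intro x hx
    have hintegral : IsIntegral ℤ x := by
      apply IsIntegral.of_pow (n := 2) two_pos
      rw [hx]
      exact RingOfIntegers.isIntegral_coe _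
    refine u_not_sq z u hz hu ⟨x, hintegral⟩ ?_
    ext
    exact hx
  have key : ∀ S : Finset ℕ, (∀ p ∈ S, p.Prime ∧ p % 8 = 3) →
      ∃ X Y : K, ((∏ p ∈ S, p : ℕ) : K) = X ^ 2 - (u : 𝓞 K) * Y ^ 2 := by
    intro S
    induction S using Finset.induction_on with
    | empty => intro _; exact ⟨1, 0, by simp⟩
    | insert p S hp ih =>
      intro h
      obtain ⟨X, Y, hXY⟩ := ih (fun q hq => h q (Finset.mem_insert_of_mem hq))
      obtain ⟨hp1, hp2⟩ := h p (Finset.mem_insert_self p S)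
      obtain ⟨a, b, hab⟩ := u_norm_prime z u hz hu p hp1 hp2
      have hb : b ≠ 0 := by
        rintro rfl
        exact huns a (by rw [← hab]; ring)
      have hp3 : (p : K) = (a / b) ^ 2 - (u : 𝓞 K) * (1 / b) ^ 2 := by
        rw [← hab]
        field_simp
        ring
      refine ⟨(a / b) * X + (u : 𝓞 K) * ((1 / b) * Y), (a / b) * Y + (1 / b) * X, ?_⟩
      rw [Finset.prod_insert hp, Nat.cast_mul, hXY, hp3]
      ring
  obtain ⟨X, Y, hXY⟩ := key d.primeFactors
    (fun p hp => ⟨Nat.prime_of_mem_primeFactors hp, hprimes p hp⟩)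
  rw [Nat.prod_primeFactors_of_squarefree hd] at hXY
  have hY : Y ≠ 0 := by
    rintro rfl
    exact d_not_sq d hd1 hd hprimes X (by rw [hXY]; ring)
  refine ⟨X / Y, 1 / Y, ?_⟩
  rw [hXY]
  field_simp
  ring

include hK hz hu in
lemma index_two (d : ℕ) (hd1 : 1 < d) (hd : Squarefree d) (hprimes : ∀ p ∈ d.primeFactors, p % 8 = 3)
    (N : Subgroup (𝓞 K)ˣ) (hN : ∀ u, u ∈ N ↔ ∃ a b : K, a ^ 2 - d * b ^ 2 = (u : 𝓞 K))
    (h4 : (powMonoidHom 2 : (𝓞 K)ˣ →* (𝓞 K)ˣ).range.index = 4) : N.index = 2 := by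
  have hle : (powMonoidHom 2 : (𝓞 K)ˣ →* (𝓞 K)ˣ).range ≤ N := by
    rintro _ ⟨v, rfl⟩
    exact zz_mem z hz d N hN v
  have h := Subgroup.relIndex_mul_index hle
  rw [h4] at h
  have h1 : N.index ≠ 1 := by
    rw [Ne, Subgroup.index_eq_one]
    intro h
    exact (not_norm z u hz hu d hd1 hd hprimes N hN).1 (h ▸ Subgroup.mem_top z)
  have h2 : (powMonoidHom 2 : (𝓞 K)ˣ →* (𝓞 K)ˣ).range.relIndex N ≠ 1 := by
    rw [Ne, Subgroup.relIndex_eq_one]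
    intro h
    obtain ⟨v, hv⟩ := h ((hN u).2 (u_norm z u hz hu d hd1 hd hprimes))
    refine u_not_sq z u hz hu v ?_
    rw [← hv]
    simp
  have h3 : N.index ∣ 4 := Dvd.intro_left _ h
  have h5 : N.index ≤ 4 := Nat.le_of_dvd (by norm_num) h3
  interval_cases N.index <;> omega

include hK in
theorem final (d : ℕ) (hd1 : 1 < d) (hd : Squarefree d) (hprimes : ∀ p ∈ d.primeFactors, p % 8 = 3)
    {L : Type*} [Field L] [NumberField L] [Algebra K L] (s : L) (hs : s ^ 2 = d)
    (hgen : Algebra.adjoin K {s} = ⊤) :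
    Nat.card {c : ClassGroup (𝓞 L) // c ^ 2 = 1} = 2 ^ (2 * d.primeFactors.card - 2) := by
  have hζ := IsCyclotomicExtension.zeta_spec 8 ℚ K
  have hζ' := hζ.toInteger_isPrimitiveRoot
  set ζ := hζ.toInteger with hζdef
  have h4 : ζ ^ 4 = -1 := by
    have h1 : (ζ ^ 4 - 1) * (ζ ^ 4 + 1) = 0 := by linear_combination hζ'.pow_eq_one
    rcases mul_eq_zero.1 h1 with h | h
    · exact absurd (sub_eq_zero.1 h) (hζ'.pow_ne_one_of_pos_of_lt (by norm_num) (by norm_num))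
    · linear_combination h
  let z : (𝓞 K)ˣ := ⟨ζ, -ζ ^ 3, by linear_combination -h4, by linear_combination -h4⟩
  let u : (𝓞 K)ˣ := ⟨ζ - ζ ^ 2 - 1, ζ ^ 3 + ζ ^ 2 - 1, by linear_combination (-ζ) * h4,
    by linear_combination (-ζ) * h4⟩
  have hz : (z : 𝓞 K) ^ 4 = -1 := h4
  have hu : (u : 𝓞 K) = z - z ^ 2 - 1 := rfl
  obtain ⟨N, hN, h1, h2⟩ := class_formula d hd1 hd hprimes s hs hgen (((z : 𝓞 K) : K) ^ 2)
    (by rw [← pow_mul]; exact_mod_cast congrArg (algebraMap (𝓞 K) K) hz)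
  rw [index_two z u hz hu d hd1 hd hprimes N hN h2] at h1
  have hpos : 0 < d.primeFactors.card := Finset.card_pos.2 (Nat.nonempty_primeFactors.2 hd1)
  have h3 : 2 * d.primeFactors.card = 2 * d.primeFactors.card - 2 + 2 := by omega
  rw [h3, pow_add] at h1
  exact Nat.eq_of_mul_eq_mul_right (by norm_num) h1

lemma gen_top {L : Type*} [Field L] [Algebra ℚ L] (ζ s : L) (hgen : Algebra.adjoin ℚ {ζ, s} = ⊤)
    (K : IntermediateField ℚ L) (hζ : ζ ∈ K) : Algebra.adjoin K {s} = ⊤ := by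
  rw [eq_top_iff]
  rintro x -
  have hx : x ∈ Algebra.adjoin ℚ {ζ, s} := by rw [hgen]; trivial
  induction hx using Algebra.adjoin_induction with
  | mem y hy =>
    rcases hy with hy | hy
    · have h := Subalgebra.algebraMap_mem (Algebra.adjoin K {s}) ⟨ζ, hζ⟩
      rw [hy]
      exact h
    · exact Algebra.subset_adjoin hy
  | algebraMap t =>
    exact Subalgebra.algebraMap_mem (Algebra.adjoin K {s}) ⟨algebraMap ℚ L t, K.algebraMap_mem t⟩
  | add a b _ _ ha hb => exact add_mem ha hb
  | mul a b _ _ ha hb => exact mul_mem ha hb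

end fin
end Amb

open NumberField
theorem stmt_16 (d : ℕ) (hd2 : 2 < d) (hd : Squarefree d)
    (r : ℕ) (hr : 2 ≤ r) (hcard : d.primeFactors.card = r)
    (hprimes : ∀ p ∈ d.primeFactors, p % 8 = 3)
    (L : Type) [Field L] [NumberField L]
    (ζ : L) (hζ : IsPrimitiveRoot ζ 8) (s : L) (hs : s ^ 2 = (d : L))
    (hgen : Algebra.adjoin ℚ {ζ, s} = ⊤) :
    Nat.card {c : ClassGroup (𝓞 L) // c ^ 2 = 1} = 2 ^ (2 * r - 2) := by
  have hcyc : IsCyclotomicExtension {8} ℚ (IntermediateField.adjoin ℚ {ζ}) :=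
    hζ.intermediateField_adjoin_isCyclotomicExtension ℚ
  rw [← hcard]
  refine Amb.final (K := IntermediateField.adjoin ℚ {ζ}) d (by omega) hd hprimes s hs ?_
  exact Amb.gen_top ζ s hgen _ (IntermediateField.mem_adjoin_simple_self ℚ ζ)
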